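/- arXiv:1302.0336 — 5 statements merged into one kernel-verified Lean document; each statement's English description precedes it below -/
import Mathlib

section
/- Let f:(0,∞)→ℝ be convex with f(1)=0. For every V ∈ [0,1], the supremum of D_f(P‖Q) over all pairs of probability measures P, Q (on all measurable spaces) satisfying V(P,Q) ≤ V equals V·(f(0) + f'(∞)), where the right-hand side is interpreted as +∞ if f(0)+f'(∞) = ∞ and V > 0. Moreover, for V > 0 the supremum is attained by P' = (1−V, V, 0) and Q' = (1−V, 0, V) on the three-point space. -/
open MeasureTheory Filter Set
open scoped ENNReal NNReal Classical

noncomputable section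

/-- The limit of `f` at `0` from the right, as an extended real number
(for `f` convex on `(0,∞)` the `limsup` below is the actual limit). -/
def limAtZero (f : ℝ → ℝ) : EReal :=
  Filter.limsup (fun x => (f x : EReal)) (nhdsWithin 0 (Set.Ioi 0))

/-- The limit of `f x / x` as `x → ∞`, as an extended real number
(for `f` convex on `(0,∞)` the `limsup` below is the actual limit). -/
def derivAtTop (f : ℝ → ℝ) : EReal :=
  Filter.limsup (fun x => ((f x / x : ℝ) : EReal)) Filter.atTop

/-- The `f`-divergence `D_f(P‖Q) = ∫_{q>0} f(p/q) dQ + f'(∞) P{q = 0}`, where the part of the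
integral over `{p = 0, q > 0}` is interpreted via the limit `f(0) := lim_{x↓0} f x`, and the part
over `{q = 0}` (the `Q`-singular part of `P`) via `f'(∞) := lim_{x→∞} f x / x`. -/
def fDiv (f : ℝ → ℝ) {Ω : Type*} [MeasurableSpace Ω] (P Q : Measure Ω) : EReal :=
  (if Integrable (fun x => f ((Measure.rnDeriv P Q x).toReal))
      (Q.restrict {x | Measure.rnDeriv P Q x ≠ 0})
   then ((∫ x in {x | Measure.rnDeriv P Q x ≠ 0},
       f ((Measure.rnDeriv P Q x).toReal) ∂Q : ℝ) : EReal)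
   else (⊤ : EReal))
  + limAtZero f * ((Q {x | Measure.rnDeriv P Q x = 0} : ℝ≥0∞) : EReal)
  + derivAtTop f * ((Measure.singularPart P Q Set.univ : ℝ≥0∞) : EReal)

/-- A pair of probability measures on an arbitrary measurable space. -/
structure PMPair where
  carrier : Type
  inst : MeasurableSpace carrier
  P : @Measure carrier inst
  Q : @Measure carrier inst
  probP : @IsProbabilityMeasure carrier inst P
  probQ : @IsProbabilityMeasure carrier inst Q

attribute [instance] PMPair.inst

/-- The total variation distance `V(P,Q) = (1/2) ∫ |p - q| dλ` (with `λ = P + Q`). -/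
def tvDist {Ω : Type*} [MeasurableSpace Ω] (P Q : Measure Ω) : ℝ :=
  (∫ x, |(Measure.rnDeriv P (P + Q) x).toReal - (Measure.rnDeriv Q (P + Q) x).toReal|
    ∂(P + Q)) / 2

/-- The function `ψ_{P,Q}(s) = ∫ min (p, q s) dλ` (with `λ = P + Q`). -/
def psiPQ {Ω : Type*} [MeasurableSpace Ω] (P Q : Measure Ω) (s : ℝ) : ℝ :=
  ∫ x, min ((Measure.rnDeriv P (P + Q) x).toReal)
    ((Measure.rnDeriv Q (P + Q) x).toReal * s) ∂(P + Q)

/-- The right derivative of `f`. -/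
def rightDeriv (f : ℝ → ℝ) (x : ℝ) : ℝ := derivWithin f (Set.Ioi x) x

/-- `ν` is the measure `ν_f` on `(0,∞)` with `ν (a,b] = ∂⁺f(b) - ∂⁺f(a)`. -/
def IsCurvatureMeasure (f : ℝ → ℝ) (ν : Measure ℝ) : Prop :=
  ∀ a b : ℝ, 0 < a → a ≤ b →
    ν (Set.Ioc a b) = ENNReal.ofReal (rightDeriv f b - rightDeriv f a)

/-- The functional `I_f(ψ) = ∫_{(0,∞)} (min(1,s) - ψ(s)) dν_f(s)`. -/
def Ifun (ν : Measure ℝ) (ψ : ℝ → ℝ) : ℝ≥0∞ :=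
  ∫⁻ s in Set.Ioi (0 : ℝ), ENNReal.ofReal (min 1 s - ψ s) ∂ν

/-- The class `C` of functions on `[0,∞)` (encoded as functions on `ℝ` vanishing on `(-∞,0)`)
that are nonnegative, concave, nondecreasing and bounded by `min(1,s)` on `[0,∞)`. -/
def Cclass : Set (ℝ → ℝ) :=
  {ψ | (∀ s, 0 ≤ s → 0 ≤ ψ s) ∧ ConcaveOn ℝ (Set.Ici 0) ψ ∧ MonotoneOn ψ (Set.Ici 0) ∧
    (∀ s, 0 ≤ s → ψ s ≤ min 1 s) ∧ ∀ s, s < 0 → ψ s = 0}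

/-- slope bound, left of one -/
lemma aux_left {f : ℝ → ℝ} (hf : ConvexOn ℝ (Set.Ioi 0) f) (hf1 : f 1 = 0)
    {x y : ℝ} (hy : 0 < y) (hyx : y < x) (hx : x < 1) : f x * (1 - y) ≤ (1 - x) * f y := by
  have h := hf.slope_mono_adjacent (x := y) (y := x) (z := 1) hy (by simp) hyx hx
  rw [div_le_div_iff₀ (by linarith) (by linarith)] at h
  nlinarith

lemma aux_mid {f : ℝ → ℝ} (hf : ConvexOn ℝ (Set.Ioi 0) f) (hf1 : f 1 = 0)
    {x y : ℝ} (hx : 0 < x) (hx1 : x < 1) (hy : 1 < y) : 0 ≤ f x * (y - 1) + f y * (1 - x) := by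
  have h := hf.slope_mono_adjacent (x := x) (y := 1) (z := y) hx
    (by simp; linarith) hx1 hy
  rw [div_le_div_iff₀ (by linarith) (by linarith)] at h
  nlinarith

lemma aux_right {f : ℝ → ℝ} (hf : ConvexOn ℝ (Set.Ioi 0) f) (hf1 : f 1 = 0)
    {x y : ℝ} (hx : 1 < x) (hxy : x < y) : f x * (y - 1) ≤ (x - 1) * f y := by
  have h := hf.slope_mono_adjacent (x := 1) (y := x) (z := y) (by simp)
    (by simp; linarith) hx hxy
  rw [div_le_div_iff₀ (by linarith) (by linarith)] at h
  nlinarith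

lemma le_limAtZero {f : ℝ → ℝ} (hf : ConvexOn ℝ (Set.Ioi 0) f) (hf1 : f 1 = 0)
    {x : ℝ} (hx : 0 < x) (hx1 : x < 1) : ((f x / (1 - x) : ℝ) : EReal) ≤ limAtZero f := by
  have ht : Tendsto (fun y : ℝ => ((f x / (1 - x) * (1 - y) : ℝ) : EReal))
      (nhdsWithin 0 (Set.Ioi 0)) (nhds ((f x / (1 - x) : ℝ) : EReal)) := by
    have h1 : Tendsto (fun y : ℝ => f x / (1 - x) * (1 - y)) (nhds 0)
        (nhds (f x / (1 - x) * (1 - 0))) := Continuous.tendsto (by fun_prop) 0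
    simp only [sub_zero, mul_one] at h1
    exact (continuous_coe_real_ereal.tendsto _).comp (h1.mono_left nhdsWithin_le_nhds)
  rw [← ht.limsup_eq]
  refine limsup_le_limsup ?_
  filter_upwards [Ioo_mem_nhdsGT hx] with y hy
  rw [EReal.coe_le_coe_iff]
  have := aux_left hf hf1 hy.1 hy.2 hx1
  rw [div_mul_eq_mul_div, div_le_iff₀ (by linarith)]
  linarith

lemma le_derivAtTop {f : ℝ → ℝ} (hf : ConvexOn ℝ (Set.Ioi 0) f) (hf1 : f 1 = 0)
    {x : ℝ} (hx : 1 < x) : ((f x / (x - 1) : ℝ) : EReal) ≤ derivAtTop f := by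
  have ht : Tendsto (fun y : ℝ => ((f x / (x - 1) * (1 - y⁻¹) : ℝ) : EReal))
      atTop (nhds ((f x / (x - 1) : ℝ) : EReal)) := by
    have h1 : Tendsto (fun y : ℝ => f x / (x - 1) * (1 - y⁻¹)) atTop
        (nhds (f x / (x - 1) * (1 - 0))) :=
      (tendsto_const_nhds.sub tendsto_inv_atTop_zero).const_mul _
    simp only [sub_zero, mul_one] at h1
    exact (continuous_coe_real_ereal.tendsto _).comp h1
  rw [← ht.limsup_eq]
  refine limsup_le_limsup ?_
  filter_upwards [Ioi_mem_atTop x] with y hy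
  rw [EReal.coe_le_coe_iff]
  have hy' : x < y := hy
  have := aux_right hf hf1 hx hy'
  rw [div_mul_eq_mul_div, div_le_div_iff₀ (by linarith) (by linarith)]
  have : (1 - y⁻¹) * y = y - 1 := by
    have : y ≠ 0 := by linarith
    field_simp
  rw [mul_assoc, this]
  linarith

lemma limAtZero_ne_bot {f : ℝ → ℝ} (hf : ConvexOn ℝ (Set.Ioi 0) f) (hf1 : f 1 = 0) :
    limAtZero f ≠ ⊥ := by
  have h := le_limAtZero hf hf1 (x := 1 / 2) (by norm_num) (by norm_num)
  intro h'
  rw [h'] at h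
  exact EReal.coe_ne_bot _ (le_bot_iff.1 h)

lemma derivAtTop_ne_bot {f : ℝ → ℝ} (hf : ConvexOn ℝ (Set.Ioi 0) f) (hf1 : f 1 = 0) :
    derivAtTop f ≠ ⊥ := by
  have h := le_derivAtTop hf hf1 (x := 2) (by norm_num)
  intro h'
  rw [h'] at h
  exact EReal.coe_ne_bot _ (le_bot_iff.1 h)

lemma f_bound {f : ℝ → ℝ} (hf : ConvexOn ℝ (Set.Ioi 0) f) (hf1 : f 1 = 0) {a b : ℝ}
    (ha : limAtZero f = a) (hb : derivAtTop f = b) {x : ℝ} (hx : 0 < x) :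
    f x ≤ a * (1 - x) + (a + b) * max (x - 1) 0 := by
  rcases lt_trichotomy x 1 with h | h | h
  · have := le_limAtZero hf hf1 hx h
    rw [ha, EReal.coe_le_coe_iff, div_le_iff₀ (by linarith)] at this
    rw [max_eq_right (by linarith)]
    linarith
  · subst h; simp [hf1]
  · have := le_derivAtTop hf hf1 h
    rw [hb, EReal.coe_le_coe_iff, div_le_iff₀ (by linarith)] at this
    rw [max_eq_left (by linarith)]
    linarith

lemma f_lower {f : ℝ → ℝ} (hf : ConvexOn ℝ (Set.Ioi 0) f) (hf1 : f 1 = 0) {x : ℝ} (hx : 0 < x) :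
    -(|f 2| + 2 * |f (1 / 2)| * x) ≤ f x := by
  have h2 := abs_nonneg (f 2)
  have h3 := abs_nonneg (f (1/2))
  have h4 := le_abs_self (f 2)
  have h5 := le_abs_self (f (1/2))
  rcases lt_trichotomy x 1 with h | h | h
  · have := aux_mid hf hf1 hx h (y := 2) (by norm_num)
    nlinarith
  · subst h; rw [hf1]; linarith
  · have := aux_mid hf hf1 (x := 1/2) (by norm_num) (by norm_num) h
    nlinarith

lemma ab_nonneg {f : ℝ → ℝ} (hf : ConvexOn ℝ (Set.Ioi 0) f) (hf1 : f 1 = 0) {a b : ℝ}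
    (ha : limAtZero f = a) (hb : derivAtTop f = b) : 0 ≤ a + b := by
  have h1 := le_limAtZero hf hf1 (x := 1/2) (by norm_num) (by norm_num)
  have h2 := le_derivAtTop hf hf1 (x := 2) (by norm_num)
  have h3 := aux_mid hf hf1 (x := 1/2) (y := 2) (by norm_num) (by norm_num) (by norm_num)
  rw [ha, EReal.coe_le_coe_iff, div_le_iff₀ (by norm_num)] at h1
  rw [hb, EReal.coe_le_coe_iff, div_le_iff₀ (by norm_num)] at h2
  linarith

lemma tv_ge {Ω : Type*} [MeasurableSpace Ω] (P Q : Measure Ω) [IsProbabilityMeasure P]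
    [IsProbabilityMeasure Q] {A : Set Ω} (hA : MeasurableSet A) :
    P.real A - Q.real A ≤ tvDist P Q := by
  have hP : P ≪ P + Q := Measure.absolutelyContinuous_of_le (Measure.le_add_right le_rfl)
  have hQ : Q ≪ P + Q := Measure.absolutelyContinuous_of_le (Measure.le_add_left le_rfl)
  have iP : Integrable (fun x => (P.rnDeriv (P + Q) x).toReal) (P + Q) :=
    Measure.integrable_toReal_rnDeriv
  have iQ : Integrable (fun x => (Q.rnDeriv (P + Q) x).toReal) (P + Q) :=
    Measure.integrable_toReal_rnDeriv
  have ig : Integrable (fun x => (P.rnDeriv (P + Q) x).toReal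
      - (Q.rnDeriv (P + Q) x).toReal) (P + Q) := iP.sub iQ
  have key : ∀ B : Set Ω, ∫ x in B, ((P.rnDeriv (P + Q) x).toReal
      - (Q.rnDeriv (P + Q) x).toReal) ∂(P + Q) = P.real B - Q.real B := by
    intro B
    rw [integral_sub iP.integrableOn iQ.integrableOn,
      Measure.setIntegral_toReal_rnDeriv hP, Measure.setIntegral_toReal_rnDeriv hQ]
  unfold tvDist
  rw [← integral_add_compl hA ig.abs]
  have h1 : ∫ x in A, ((P.rnDeriv (P + Q) x).toReal
      - (Q.rnDeriv (P + Q) x).toReal) ∂(P + Q) ≤ ∫ x in A, |(P.rnDeriv (P + Q) x).toReal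
      - (Q.rnDeriv (P + Q) x).toReal| ∂(P + Q) :=
    integral_mono ig.integrableOn ig.abs.integrableOn fun x => le_abs_self _
  have h2 : -∫ x in Aᶜ, ((P.rnDeriv (P + Q) x).toReal
      - (Q.rnDeriv (P + Q) x).toReal) ∂(P + Q) ≤ ∫ x in Aᶜ, |(P.rnDeriv (P + Q) x).toReal
      - (Q.rnDeriv (P + Q) x).toReal| ∂(P + Q) := by
    rw [← integral_neg]
    exact integral_mono ig.integrableOn.neg ig.abs.integrableOn fun x => neg_le_abs _
  rw [key] at h1 h2
  rw [probReal_compl_eq_one_sub hA, probReal_compl_eq_one_sub hA] at h2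
  have h3 : P.real A - Q.real A ≤ ((∫ x in A, |(P.rnDeriv (P + Q) x).toReal
      - (Q.rnDeriv (P + Q) x).toReal| ∂(P + Q)) + ∫ x in Aᶜ, |(P.rnDeriv (P + Q) x).toReal
      - (Q.rnDeriv (P + Q) x).toReal| ∂(P + Q)) / 2 := by linarith
  exact h3

lemma tv_ge' {Ω : Type*} [MeasurableSpace Ω] (P Q : Measure Ω) [IsProbabilityMeasure P]
    [IsProbabilityMeasure Q] :
    ∫ x, max ((P.rnDeriv Q x).toReal - 1) 0 ∂Q + (P.singularPart Q).real univ ≤ tvDist P Q := by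
  obtain ⟨S, hS, hS1, hS2⟩ := Measure.mutuallySingular_singularPart P Q
  have iP : Integrable (fun x => (P.rnDeriv Q x).toReal) Q := Measure.integrable_toReal_rnDeriv
  set T : Set Ω := {x | 1 ≤ (P.rnDeriv Q x).toReal} with hT
  have hTm : MeasurableSet T :=
    measurableSet_le measurable_const (Measure.measurable_rnDeriv P Q).ennreal_toReal
  have hA : MeasurableSet (T ∪ Sᶜ) := hTm.union hS.compl
  refine le_trans (le_of_eq ?_) (tv_ge P Q hA)
  have h1 : ∫ x, max ((P.rnDeriv Q x).toReal - 1) 0 ∂Q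
      = ∫ x in T, ((P.rnDeriv Q x).toReal - 1) ∂Q := by
    rw [← integral_indicator hTm]
    congr 1
    ext x
    by_cases hx : x ∈ T
    · rw [indicator_of_mem hx]
      exact max_eq_left (by simpa [hT] using hx)
    · rw [indicator_of_notMem hx]
      refine max_eq_right ?_
      simp only [hT, mem_ofPred_eq, not_le] at hx
      linarith
  have hae : (T ∪ Sᶜ : Set Ω) =ᵐ[Q] T := by
    refine union_ae_eq_left_of_ae_eq_empty ?_
    exact ae_eq_empty.2 hS2
  have hQA : Q.real (T ∪ Sᶜ) = Q.real T := measureReal_congr hae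
  have hPA : P.real (T ∪ Sᶜ) = (P.singularPart Q).real univ
      + ∫ x in T, (P.rnDeriv Q x).toReal ∂Q := by
    conv_lhs => rw [← Measure.singularPart_add_rnDeriv P Q]
    rw [measureReal_add_apply]
    congr 1
    · rw [← measureReal_congr (s := (univ : Set Ω))]
      refine EventuallyEq.symm (ae_eq_univ.2 ?_)
      refine measure_mono_null ?_ hS1
      intro x hx
      simp at hx
      exact hx.2
    · rw [← Measure.setIntegral_toReal_rnDeriv_eq_withDensity]
      exact setIntegral_congr_set hae
  rw [hQA, hPA, h1, integral_sub iP.integrableOn (integrable_const _)]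
  simp
  ring

lemma fDiv_le {Ω : Type*} [MeasurableSpace Ω] (P Q : Measure Ω) [IsProbabilityMeasure P]
    [IsProbabilityMeasure Q] {f : ℝ → ℝ} (hf : ConvexOn ℝ (Set.Ioi 0) f) (hf1 : f 1 = 0) {a b : ℝ}
    (ha : limAtZero f = a) (hb : derivAtTop f = b) :
    fDiv f P Q ≤ ((tvDist P Q * (a + b) : ℝ) : EReal) := by
  have iP : Integrable (fun x => (P.rnDeriv Q x).toReal) Q := Measure.integrable_toReal_rnDeriv
  have hrm : Measurable (fun x => (P.rnDeriv Q x).toReal) :=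
    (Measure.measurable_rnDeriv P Q).ennreal_toReal
  set N : Set Ω := {x | P.rnDeriv Q x ≠ 0} with hN
  have hNm : MeasurableSet N := (Measure.measurable_rnDeriv P Q) (measurableSet_singleton 0).compl
  have hNc : {x | P.rnDeriv Q x = 0} = Nᶜ := by ext; simp [hN]
  have hpos : ∀ᵐ x ∂(Q.restrict N), 0 < (P.rnDeriv Q x).toReal := by
    filter_upwards [ae_restrict_mem hNm, ae_restrict_of_ae (Measure.rnDeriv_lt_top P Q)]
      with x hx hx2
    exact ENNReal.toReal_pos hx hx2.ne
  have imax : Integrable (fun x => max ((P.rnDeriv Q x).toReal - 1) 0) Q :=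
    (iP.sub (integrable_const 1)).pos_part
  have iub : Integrable (fun x => a * (1 - (P.rnDeriv Q x).toReal)
      + (a + b) * max ((P.rnDeriv Q x).toReal - 1) 0) Q :=
    (((integrable_const 1).sub iP).const_mul a).add (imax.const_mul _)
  have ilb : Integrable (fun x => -(|f 2| + 2 * |f (1 / 2)| * (P.rnDeriv Q x).toReal)) Q :=
    ((integrable_const _).add (iP.const_mul _)).neg
  have hmeas : AEStronglyMeasurable (fun x => f ((P.rnDeriv Q x).toReal)) (Q.restrict N) := by
    have hg : Measurable ((Set.Ioi (0 : ℝ)).piecewise f (fun _ => 0)) :=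
      (hf.continuousOn isOpen_Ioi).measurable_piecewise continuousOn_const measurableSet_Ioi
    refine (hg.comp hrm).aestronglyMeasurable.congr ?_
    filter_upwards [hpos] with x hx
    simp [Set.piecewise, hx]
  have hub : ∀ᵐ x ∂(Q.restrict N), f ((P.rnDeriv Q x).toReal) ≤
      a * (1 - (P.rnDeriv Q x).toReal) + (a + b) * max ((P.rnDeriv Q x).toReal - 1) 0 := by
    filter_upwards [hpos] with x hx using f_bound hf hf1 ha hb hx
  have hlb : ∀ᵐ x ∂(Q.restrict N), -(|f 2| + 2 * |f (1 / 2)| * (P.rnDeriv Q x).toReal) ≤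
      f ((P.rnDeriv Q x).toReal) := by
    filter_upwards [hpos] with x hx using f_lower hf hf1 hx
  have hint : Integrable (fun x => f ((P.rnDeriv Q x).toReal)) (Q.restrict N) :=
    integrable_of_le_of_le hmeas hlb hub ilb.integrableOn iub.integrableOn
  have hI : ∫ x in N, f ((P.rnDeriv Q x).toReal) ∂Q ≤ ∫ x in N, (a * (1 - (P.rnDeriv Q x).toReal)
      + (a + b) * max ((P.rnDeriv Q x).toReal - 1) 0) ∂Q :=
    integral_mono_ae hint iub.integrableOn hub
  have hsplit := integral_add_compl hNm iub
  have hc : ∫ x in Nᶜ, (a * (1 - (P.rnDeriv Q x).toReal)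
      + (a + b) * max ((P.rnDeriv Q x).toReal - 1) 0) ∂Q = a * Q.real Nᶜ := by
    rw [setIntegral_congr_fun (g := fun _ => a) hNm.compl]
    · simp [mul_comm]
    · intro x hx
      have : P.rnDeriv Q x = 0 := by simpa [hN] using hx
      simp [this]
  have htot : ∫ x, (a * (1 - (P.rnDeriv Q x).toReal)
      + (a + b) * max ((P.rnDeriv Q x).toReal - 1) 0) ∂Q = a * (P.singularPart Q).real univ
      + (a + b) * ∫ x, max ((P.rnDeriv Q x).toReal - 1) 0 ∂Q := by
    have i1 : Integrable (fun x => a * (1 - (P.rnDeriv Q x).toReal)) Q :=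
      ((integrable_const 1).sub iP).const_mul a
    rw [integral_add i1 (imax.const_mul _),
      integral_const_mul, integral_const_mul, integral_sub (integrable_const 1) iP,
      Measure.integral_toReal_rnDeriv']
    simp
  have htv := tv_ge' P Q
  have hab := ab_nonneg hf hf1 ha hb
  unfold fDiv
  rw [if_pos hint, ha, hb, hNc]
  have e1 : ((Q Nᶜ : ℝ≥0∞) : EReal) = ((Q.real Nᶜ : ℝ) : EReal) :=
    (EReal.coe_ennreal_toReal (measure_ne_top _ _)).symm
  have e2 : ((P.singularPart Q univ : ℝ≥0∞) : EReal)
      = (((P.singularPart Q).real univ : ℝ) : EReal) :=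
    (EReal.coe_ennreal_toReal (measure_ne_top _ _)).symm
  rw [e1, e2]
  norm_cast
  nlinarith

lemma eq_of_tv {Ω : Type*} [MeasurableSpace Ω] (P Q : Measure Ω) [IsProbabilityMeasure P]
    [IsProbabilityMeasure Q] (h : tvDist P Q ≤ 0) : P = Q := by
  have key : ∀ A, MeasurableSet A → P.real A ≤ Q.real A := by
    intro A hA
    have := tv_ge P Q hA
    linarith
  ext A hA
  have h1 := key A hA
  have h2 := key _ hA.compl
  rw [probReal_compl_eq_one_sub hA, probReal_compl_eq_one_sub hA] at h2
  rw [← measureReal_eq_measureReal_iff]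
  linarith

lemma fDiv_self {Ω : Type*} [MeasurableSpace Ω] (P : Measure Ω) [IsProbabilityMeasure P]
    {f : ℝ → ℝ} (hf1 : f 1 = 0) : fDiv f P P = 0 := by
  have h := Measure.rnDeriv_self P
  have h0 : (fun x => f ((P.rnDeriv P x).toReal))
      =ᵐ[P.restrict {x | P.rnDeriv P x ≠ 0}] fun _ => 0 := by
    filter_upwards [ae_restrict_of_ae h] with x hx
    simp [hx, hf1]
  have h1 : P {x | P.rnDeriv P x = 0} = 0 := by
    have : ∀ᵐ x ∂P, ¬ (P.rnDeriv P x = 0) := by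
      filter_upwards [h] with x hx
      simp [hx]
    simpa [ae_iff] using this
  unfold fDiv
  rw [if_pos ((integrable_congr h0).2 (integrable_zero _ _ _)), integral_congr_ae h0, h1,
    Measure.singularPart_self]
  simp

lemma tv_self {Ω : Type*} [MeasurableSpace Ω] (P : Measure Ω) : tvDist P P = 0 := by
  simp [tvDist]

lemma three_point {f : ℝ → ℝ} (hf : ConvexOn ℝ (Set.Ioi 0) f) (hf1 : f 1 = 0)
    {V : ℝ} (hV0 : 0 ≤ V) (hV1 : V ≤ 1)
    (P Q : Measure (Fin 3)) [IsProbabilityMeasure P] [IsProbabilityMeasure Q]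
    (p0 : P {0} = ENNReal.ofReal (1 - V)) (p1 : P {1} = ENNReal.ofReal V) (p2 : P {2} = 0)
    (q0 : Q {0} = ENNReal.ofReal (1 - V)) (q1 : Q {1} = 0) (q2 : Q {2} = ENNReal.ofReal V) :
    tvDist P Q ≤ V ∧ fDiv f P Q = (V : EReal) * (limAtZero f + derivAtTop f) := by
  constructor
  · have hP : P ≪ P + Q := Measure.absolutelyContinuous_of_le (Measure.le_add_right le_rfl)
    have hQ : Q ≪ P + Q := Measure.absolutelyContinuous_of_le (Measure.le_add_left le_rfl)
    have kP := fun i : Fin 3 => Measure.setIntegral_toReal_rnDeriv hP {i}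
    have kQ := fun i : Fin 3 => Measure.setIntegral_toReal_rnDeriv hQ {i}
    simp only [integral_singleton, smul_eq_mul] at kP kQ
    unfold tvDist
    rw [integral_fintype (Integrable.of_finite)]
    have key : ∀ i : Fin 3, (P + Q).real {i} • |(P.rnDeriv (P + Q) i).toReal
        - (Q.rnDeriv (P + Q) i).toReal| = |P.real {i} - Q.real {i}| := by
      intro i
      rw [← kP, ← kQ, ← mul_sub, abs_mul, abs_of_nonneg measureReal_nonneg, smul_eq_mul]
    rw [Finset.sum_congr rfl (fun i _ => key i)]
    simp only [Fin.sum_univ_three, measureReal_def, p0, p1, p2, q0, q1, q2]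
    simp [ENNReal.toReal_ofReal hV0, abs_of_nonneg hV0]
  · set g : Fin 3 → ℝ≥0∞ := ![1, 0, 0] with hg
    set s : Measure (Fin 3) := ENNReal.ofReal V • Measure.dirac 1 with hs
    have hsing : s ⟂ₘ Q := by
      refine ⟨{1}ᶜ, MeasurableSet.of_discrete, ?_, ?_⟩
      · simp [hs]
      · simpa using q1
    have hadd : P = s + Q.withDensity g := by
      refine Measure.ext_of_singleton fun i => ?_
      rw [Measure.add_apply, withDensity_apply _ (measurableSet_singleton i)]
      fin_cases i <;> simp [hs, hg, p0, p1, p2, q0, q1, q2]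
    have hr := Measure.eq_rnDeriv (Measurable.of_discrete) hsing hadd
    have hsg := Measure.eq_singularPart (Measurable.of_discrete) hsing hadd
    have h1n : ∀ᵐ x ∂Q, x ≠ 1 := by simpa [ae_iff] using q1
    have h0 : (fun x => f ((P.rnDeriv Q x).toReal))
        =ᵐ[Q.restrict {x | P.rnDeriv Q x ≠ 0}] fun _ => 0 := by
      filter_upwards [ae_restrict_of_ae hr, ae_restrict_mem MeasurableSet.of_discrete] with x hx hx2
      replace hx2 : P.rnDeriv Q x ≠ 0 := hx2
      rw [← hx] at hx2
      rw [← hx]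
      fin_cases x <;> simp [hg, hf1] at hx2 ⊢
    have h2 : Q {x | P.rnDeriv Q x = 0} = ENNReal.ofReal V := by
      rw [← q2]
      refine measure_congr ?_
      filter_upwards [hr, h1n] with x hx hx1
      apply propext
      change P.rnDeriv Q x = 0 ↔ x = 2
      rw [← hx]
      fin_cases x <;> simp [hg] at hx1 ⊢
    have h3 : P.singularPart Q univ = ENNReal.ofReal V := by
      rw [← hsg]; simp [hs]
    unfold fDiv
    rw [if_pos ((integrable_congr h0).2 (integrable_zero _ _ _)), integral_congr_ae h0, h2, h3]
    have e : ((ENNReal.ofReal V : ℝ≥0∞) : EReal) = (V : EReal) := by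
      simp [EReal.coe_ennreal_ofReal, hV0]
    rw [e, EReal.left_distrib_of_nonneg_of_ne_top (by exact_mod_cast hV0) (EReal.coe_ne_top _)]
    simp [mul_comm]

/-- **Section 4.3.** The supremum of `D_f(P‖Q)` subject to `V(P,Q) ≤ V` equals
`V ⋅ (f(0) + f'(∞))` (in the extended reals, so it is `+∞` when `f(0) + f'(∞) = ∞` and
`V > 0`), and for `V > 0` it is attained by `P' = (1-V, V, 0)` and `Q' = (1-V, 0, V)` on the
three-point space. -/
theorem sup_fDiv_tv_constraint (f : ℝ → ℝ)
    (hf : ConvexOn ℝ (Set.Ioi 0) f) (hf1 : f 1 = 0)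
    (V : ℝ) (hV0 : 0 ≤ V) (hV1 : V ≤ 1) :
    sSup {x : EReal | ∃ pp : PMPair, tvDist pp.P pp.Q ≤ V ∧ x = fDiv f pp.P pp.Q}
      = (V : EReal) * (limAtZero f + derivAtTop f) ∧
    (0 < V → ∀ P' Q' : Measure (Fin 3),
      IsProbabilityMeasure P' → IsProbabilityMeasure Q' →
      P' {0} = ENNReal.ofReal (1 - V) → P' {1} = ENNReal.ofReal V → P' {2} = 0 →
      Q' {0} = ENNReal.ofReal (1 - V) → Q' {1} = 0 → Q' {2} = ENNReal.ofReal V →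
      tvDist P' Q' ≤ V ∧
        fDiv f P' Q' = (V : EReal) * (limAtZero f + derivAtTop f)) := by
  have hatt : ∀ P' Q' : Measure (Fin 3),
      IsProbabilityMeasure P' → IsProbabilityMeasure Q' →
      P' {0} = ENNReal.ofReal (1 - V) → P' {1} = ENNReal.ofReal V → P' {2} = 0 →
      Q' {0} = ENNReal.ofReal (1 - V) → Q' {1} = 0 → Q' {2} = ENNReal.ofReal V →
      tvDist P' Q' ≤ V ∧
        fDiv f P' Q' = (V : EReal) * (limAtZero f + derivAtTop f) := by
    intro P' Q' _ _ p0 p1 p2 q0 q1 q2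
    exact three_point hf hf1 hV0 hV1 P' Q' p0 p1 p2 q0 q1 q2
  refine ⟨le_antisymm (sSup_le ?_) (le_sSup ?_), fun _ => hatt⟩
  · rintro _ ⟨pp, hpp, rfl⟩
    have := pp.probP
    have := pp.probQ
    rcases hV0.eq_or_lt with h | h
    · rw [← h] at hpp ⊢
      have := eq_of_tv _ _ hpp
      rw [this, fDiv_self _ hf1]
      simp
    · have ha := limAtZero_ne_bot hf hf1
      have hb := derivAtTop_ne_bot hf hf1
      by_cases ha' : limAtZero f = ⊤
      · rw [ha', EReal.top_add_of_ne_bot hb, EReal.coe_mul_top_of_pos h]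
        exact le_top
      by_cases hb' : derivAtTop f = ⊤
      · rw [hb', EReal.add_top_of_ne_bot ha, EReal.coe_mul_top_of_pos h]
        exact le_top
      have ha2 := (EReal.coe_toReal ha' ha).symm
      have hb2 := (EReal.coe_toReal hb' hb).symm
      refine (fDiv_le pp.P pp.Q hf hf1 ha2 hb2).trans ?_
      have hab := ab_nonneg hf hf1 ha2 hb2
      rw [ha2, hb2]
      simp only [EReal.toReal_coe]
      norm_cast
      exact mul_le_mul_of_nonneg_right hpp hab
  · set P' : Measure (Fin 3) := ENNReal.ofReal (1 - V) • Measure.dirac 0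
      + ENNReal.ofReal V • Measure.dirac 1 with hP'
    set Q' : Measure (Fin 3) := ENNReal.ofReal (1 - V) • Measure.dirac 0
      + ENNReal.ofReal V • Measure.dirac 2 with hQ'
    have hsum : ENNReal.ofReal (1 - V) + ENNReal.ofReal V = 1 := by
      rw [← ENNReal.ofReal_add (by linarith) hV0]; simp
    have iP : IsProbabilityMeasure P' := ⟨by simp [hP', hsum]⟩
    have iQ : IsProbabilityMeasure Q' := ⟨by simp [hQ', hsum]⟩
    have := hatt P' Q' iP iQ (by simp [hP']) (by simp [hP']) (by simp [hP'])
      (by simp [hQ']) (by simp [hQ']) (by simp [hQ'])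
    exact ⟨⟨Fin 3, inferInstance, P', Q', iP, iQ⟩, this.1, this.2.symm⟩

end
end

section
/- Let f:(0,∞)→ℝ be convex with f(1)=0, strictly convex on (0,∞), and such that D_f is a finite divergence. For V ∈ [0,1] let A_k(V) := sup{D_f(P‖Q) : P, Q probability measures on {1,…,k}, V(P,Q) ≤ V}. Then A_3(V) > A_2(V) for every V ∈ (0,1). (In particular, the reduction to (m+2)-point spaces in the main theorem cannot in general be improved to (m+1)-point spaces.) -/
open MeasureTheory Filter Set
open scoped ENNReal NNReal Classical

noncomputable section

lemma aux_le_limAtZero {f : ℝ → ℝ} (hf : ConvexOn ℝ (Set.Ioi 0) f) {x y : ℝ}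
    (hx : 0 < x) (hxy : x < y) :
    ((f x - (f y - f x) / (y - x) * x : ℝ) : EReal) ≤ limAtZero f := by
  set s := (f y - f x) / (y - x) with hs
  have ht : Tendsto (fun z : ℝ => ((f x + s * (z - x) : ℝ) : EReal)) (nhdsWithin 0 (Set.Ioi 0))
      (nhds ((f x - s * x : ℝ) : EReal)) := by
    apply (continuous_coe_real_ereal.tendsto _).comp
    have : Continuous (fun z : ℝ => f x + s * (z - x)) := by fun_prop
    have h2 := (this.tendsto 0).mono_left (nhdsWithin_le_nhds (s := Set.Ioi 0))
    convert h2 using 2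
    ring
  rw [← ht.limsup_eq]
  unfold limAtZero
  apply limsup_le_limsup
  · have hmem : Set.Ioo (0:ℝ) x ∈ nhdsWithin 0 (Set.Ioi 0) := Ioo_mem_nhdsGT hx
    filter_upwards [hmem] with z hz
    rw [EReal.coe_le_coe_iff]
    have h := hf.slope_mono_adjacent (x := z) (y := x) (z := y) hz.1 (hx.trans hxy) hz.2 hxy
    rw [← hs, div_le_iff₀ (by linarith [hz.2])] at h
    linarith
  · isBoundedDefault
  · isBoundedDefault

lemma aux_le_derivAtTop {f : ℝ → ℝ} (hf : ConvexOn ℝ (Set.Ioi 0) f) {x y : ℝ}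
    (hx : 0 < x) (hxy : x < y) :
    (((f y - f x) / (y - x) : ℝ) : EReal) ≤ derivAtTop f := by
  set s := (f y - f x) / (y - x) with hs
  have ht : Tendsto (fun z : ℝ => (((f y - s * y) / z + s : ℝ) : EReal)) atTop
      (nhds ((s : ℝ) : EReal)) := by
    apply (continuous_coe_real_ereal.tendsto _).comp
    have h2 : Tendsto (fun z : ℝ => (f y - s * y) / z + s) atTop (nhds (0 + s)) :=
      (tendsto_const_nhds.div_atTop tendsto_id).add tendsto_const_nhds
    simpa using h2
  rw [← ht.limsup_eq]
  unfold derivAtTop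
  apply limsup_le_limsup
  · filter_upwards [eventually_gt_atTop y] with z hz
    rw [EReal.coe_le_coe_iff]
    have hz0 : 0 < z := hx.trans (hxy.trans hz)
    have h := hf.slope_mono_adjacent (x := x) (y := y) (z := z) hx hz0 hxy hz
    rw [← hs, le_div_iff₀ (by linarith)] at h
    rw [div_add' _ _ _ hz0.ne', div_le_div_iff_of_pos_right hz0]
    linarith
  · isBoundedDefault
  · isBoundedDefault

section fin
variable {Ω : Type*} [Fintype Ω] [MeasurableSpace Ω] [MeasurableSingletonClass Ω]

lemma aux_decomp (P Q : Measure Ω) [IsFiniteMeasure P] [IsFiniteMeasure Q] (i : Ω) :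
    P.real {i} = (P.singularPart Q).real {i} + (P.rnDeriv Q i).toReal * Q.real {i} := by
  have h : P {i} = P.singularPart Q {i} + P.rnDeriv Q i * Q {i} := by
    conv_lhs => rw [Measure.haveLebesgueDecomposition_add P Q]
    rw [Measure.add_apply, withDensity_apply _ (measurableSet_singleton i), lintegral_singleton]
  have h1 : P.singularPart Q {i} ≠ ⊤ := measure_ne_top _ _
  have h2 : P.rnDeriv Q i * Q {i} ≠ ⊤ := by
    intro h3
    rw [h3] at h
    simp at h
  simp only [measureReal_def]
  rw [h, ENNReal.toReal_add h1 h2, ENNReal.toReal_mul]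

lemma aux_sing (P Q : Measure Ω) [IsFiniteMeasure P] [IsFiniteMeasure Q] (i : Ω)
    (h : Q.real {i} ≠ 0) : (P.singularPart Q).real {i} = 0 := by
  obtain ⟨t, -, h1, h2⟩ := Measure.mutuallySingular_singularPart P Q
  by_cases hi : i ∈ t
  · rw [measureReal_def, measure_mono_null (by simpa using hi) h1]; rfl
  · exfalso
    apply h
    rw [measureReal_def, measure_mono_null (by simpa using hi) h2]; rfl

lemma aux_tv (P Q : Measure Ω) [IsFiniteMeasure P] [IsFiniteMeasure Q] :
    tvDist P Q = (∑ i, |P.real {i} - Q.real {i}|) / 2 := by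
  unfold tvDist
  rw [integral_fintype Integrable.of_finite]
  congr 1
  apply Finset.sum_congr rfl
  intro i _
  have hadd : (P + Q).real {i} = P.real {i} + Q.real {i} := by
    simp [measureReal_def, ENNReal.toReal_add]
  have hP := aux_decomp P (P + Q) i
  have hQ := aux_decomp Q (P + Q) i
  have p0 : 0 ≤ P.real {i} := measureReal_nonneg
  have q0 : 0 ≤ Q.real {i} := measureReal_nonneg
  by_cases h : (P + Q).real {i} = 0
  · rw [h]
    have h1 : P.real {i} = 0 := by linarith
    have h2 : Q.real {i} = 0 := by linarith
    rw [h1, h2]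
    simp
  · rw [aux_sing _ _ _ h, zero_add] at hP hQ
    rw [hP, hQ, ← sub_mul, abs_mul, abs_of_nonneg (measureReal_nonneg (μ := P + Q) (s := {i})),
      smul_eq_mul, mul_comm]

lemma aux_real_sum (μ : Measure Ω) [IsFiniteMeasure μ] (s : Set Ω) :
    μ.real s = ∑ i, if i ∈ s then μ.real {i} else 0 := by
  rw [← Finset.sum_filter, sum_measureReal_singleton]
  simp

lemma aux_fDiv (f : ℝ → ℝ) (P Q : Measure Ω) [IsFiniteMeasure P] [IsFiniteMeasure Q] :
    fDiv f P Q =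
      ((∑ i, if P.real {i} = 0 then 0 else Q.real {i} * f (P.real {i} / Q.real {i}) : ℝ) : EReal)
      + limAtZero f * ((∑ i, if P.real {i} = 0 then Q.real {i} else 0 : ℝ) : EReal)
      + derivAtTop f * ((∑ i, if Q.real {i} = 0 then P.real {i} else 0 : ℝ) : EReal) := by
  have key : ∀ i, Q.real {i} ≠ 0 → (P.rnDeriv Q i).toReal = P.real {i} / Q.real {i} := by
    intro i h
    rw [aux_decomp P Q i, aux_sing P Q i h, zero_add, mul_div_cancel_right₀ _ h]
  have htop : ∀ i, Q.real {i} ≠ 0 → P.rnDeriv Q i ≠ ⊤ := by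
    intro i h
    have := Measure.rnDeriv_lt_top P Q
    rw [ae_iff] at this
    intro h2
    apply h
    rw [measureReal_def, measure_mono_null (by simp [h2]) this]; rfl
  have iff0 : ∀ i, Q.real {i} ≠ 0 → (P.rnDeriv Q i = 0 ↔ P.real {i} = 0) := by
    intro i h
    have h1 := key i h
    have h2 := ENNReal.toReal_eq_zero_iff (P.rnDeriv Q i)
    simp only [htop i h, or_false] at h2
    rw [← h2, h1, div_eq_zero_iff]
    simp [h]
  unfold fDiv
  rw [if_pos Integrable.of_finite]
  congr 1
  · congr 1
    · rw [EReal.coe_eq_coe_iff, integral_fintype Integrable.of_finite]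
      apply Finset.sum_congr rfl
      intro i _
      have hr : (Q.restrict {x | P.rnDeriv Q x ≠ 0}).real {i} =
          if P.rnDeriv Q i = 0 then 0 else Q.real {i} := by
        rw [measureReal_restrict_apply (measurableSet_singleton i)]
        split_ifs with h
        · have : ({i} ∩ {x | P.rnDeriv Q x ≠ 0} : Set Ω) = ∅ := by
            ext j; simp; rintro rfl; exact h
          simp [this]
        · have : ({i} ∩ {x | P.rnDeriv Q x ≠ 0} : Set Ω) = {i} := by
            ext j; simp; rintro rfl; exact h
          rw [this]
      rw [hr]
      by_cases hq : Q.real {i} = 0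
      · simp [hq]
      · simp only [iff0 i hq, key i hq]
        split_ifs <;> simp
    · congr 1
      rw [← EReal.coe_ennreal_toReal (measure_ne_top _ _), EReal.coe_eq_coe_iff,
        ← measureReal_def, aux_real_sum]
      apply Finset.sum_congr rfl
      intro i _
      by_cases hq : Q.real {i} = 0
      · simp [hq]
      · simp only [Set.mem_ofPred_eq, iff0 i hq]
  · congr 1
    rw [← EReal.coe_ennreal_toReal (measure_ne_top _ _), EReal.coe_eq_coe_iff,
        ← measureReal_def, aux_real_sum]
    apply Finset.sum_congr rfl
    intro i _
    by_cases hq : Q.real {i} = 0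
    · rw [aux_decomp P Q i]; simp [hq]
    · simp [aux_sing P Q i hq, hq]

end fin

/-- The perspective function. -/
def auxTerm (f : ℝ → ℝ) (a b p q : ℝ) : ℝ :=
  if p = 0 then a * q else if q = 0 then b * p else q * f (p / q)

lemma aux_fDiv_real {Ω : Type*} [Fintype Ω] [MeasurableSpace Ω] [MeasurableSingletonClass Ω]
    (f : ℝ → ℝ) (a b : ℝ) (ha : limAtZero f = a) (hb : derivAtTop f = b)
    (P Q : Measure Ω) [IsFiniteMeasure P] [IsFiniteMeasure Q] :
    fDiv f P Q = ((∑ i, auxTerm f a b (P.real {i}) (Q.real {i}) : ℝ) : EReal) := by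
  rw [aux_fDiv, ha, hb, ← EReal.coe_mul, ← EReal.coe_mul, ← EReal.coe_add, ← EReal.coe_add,
    EReal.coe_eq_coe_iff, Finset.mul_sum, Finset.mul_sum, ← Finset.sum_add_distrib,
    ← Finset.sum_add_distrib]
  apply Finset.sum_congr rfl
  intro i _
  unfold auxTerm
  by_cases h1 : P.real {i} = 0 <;> by_cases h2 : Q.real {i} = 0 <;> simp [h1, h2]

/-- Measure on a finite type with prescribed masses. -/
def auxM {n : ℕ} (p : Fin n → ℝ) : Measure (Fin n) :=
  ∑ i, ENNReal.ofReal (p i) • Measure.dirac i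

lemma auxM_apply {n : ℕ} (p : Fin n → ℝ) (i : Fin n) : auxM p {i} = ENNReal.ofReal (p i) := by
  unfold auxM
  simp [Measure.finsetSum_apply, Measure.dirac_apply, Set.indicator_apply]

lemma auxM_real {n : ℕ} (p : Fin n → ℝ) (hp : ∀ i, 0 ≤ p i) (i : Fin n) :
    (auxM p).real {i} = p i := by
  rw [measureReal_def, auxM_apply, ENNReal.toReal_ofReal (hp i)]

lemma auxM_prob {n : ℕ} (p : Fin n → ℝ) (hp : ∀ i, 0 ≤ p i) (h1 : ∑ i, p i = 1) :
    IsProbabilityMeasure (auxM p) := by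
  constructor
  unfold auxM
  simp [Measure.finsetSum_apply]
  rw [← ENNReal.ofReal_sum_of_nonneg (fun i _ => hp i), h1, ENNReal.ofReal_one]

lemma aux_finite {f : ℝ → ℝ} (hf : ConvexOn ℝ (Set.Ioi 0) f)
    (hfin : sSup {x : EReal | ∃ pp : PMPair, x = fDiv f pp.P pp.Q} < ⊤) :
    ∃ a b : ℝ, limAtZero f = a ∧ derivAtTop f = b := by
  have hp : ∀ i, 0 ≤ (![0, 1] : Fin 2 → ℝ) i := by intro i; fin_cases i <;> simp
  have hq : ∀ i, 0 ≤ (![1, 0] : Fin 2 → ℝ) i := by intro i; fin_cases i <;> simp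
  have i1 : IsProbabilityMeasure (auxM (![0, 1] : Fin 2 → ℝ)) := auxM_prob _ hp (by simp)
  have i2 : IsProbabilityMeasure (auxM (![1, 0] : Fin 2 → ℝ)) := auxM_prob _ hq (by simp)
  have hlt : fDiv f (auxM (![0, 1] : Fin 2 → ℝ)) (auxM (![1, 0] : Fin 2 → ℝ)) < ⊤ :=
    lt_of_le_of_lt (le_sSup (show _ ∈ {x : EReal | ∃ pp : PMPair, x = fDiv f pp.P pp.Q} from
      ⟨PMPair.mk (Fin 2) inferInstance _ _ i1 i2, rfl⟩)) hfin
  have h0 : limAtZero f ≠ ⊥ := by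
    intro h
    have := aux_le_limAtZero hf one_pos one_lt_two
    rw [h, le_bot_iff] at this
    exact EReal.coe_ne_bot _ this
  have h1 : derivAtTop f ≠ ⊥ := by
    intro h
    have := aux_le_derivAtTop hf one_pos one_lt_two
    rw [h, le_bot_iff] at this
    exact EReal.coe_ne_bot _ this
  rw [aux_fDiv] at hlt
  simp [Fin.sum_univ_two, auxM_real _ hp, auxM_real _ hq] at hlt
  have h2 : limAtZero f ≠ ⊤ := by
    intro h
    rw [h, EReal.top_add_of_ne_bot h1] at hlt
    exact lt_irrefl _ hlt
  have h3 : derivAtTop f ≠ ⊤ := by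
    intro h
    rw [h, EReal.add_top_of_ne_bot h0] at hlt
    exact lt_irrefl _ hlt
  exact ⟨_, _, (EReal.coe_toReal h2 h0).symm, (EReal.coe_toReal h3 h1).symm⟩

section real
variable {f : ℝ → ℝ} {a b : ℝ}

lemma aux_b_strict (hs : StrictConvexOn ℝ (Set.Ioi 0) f) (hf1 : f 1 = 0)
    (hb : ∀ x y, 0 < x → x < y → (f y - f x) / (y - x) ≤ b) {x : ℝ} (hx : 1 < x) :
    f x < b * (x - 1) := by
  have h := hs.slope_strict_mono_adjacent (x := 1) (y := x) (z := x + 1) (by simp)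
    (show (0:ℝ) < x + 1 by linarith) hx (by linarith)
  have h2 := hb x (x + 1) (by linarith) (by linarith)
  have h3 := h.trans_le h2
  rw [div_lt_iff₀ (by linarith), hf1] at h3
  linarith

lemma aux_a_strict (hs : StrictConvexOn ℝ (Set.Ioi 0) f) (hf1 : f 1 = 0)
    (ha : ∀ x y, 0 < x → x < y → f x - (f y - f x) / (y - x) * x ≤ a) {x : ℝ}
    (hx0 : 0 < x) (hx : x < 1) :
    f x < a * (1 - x) := by
  have h := hs.slope_strict_mono_adjacent (x := x / 2) (y := x) (z := 1)
    (show (0:ℝ) < x / 2 by linarith) (by simp) (by linarith) hx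
  have h2 := ha (x / 2) x (by linarith) (by linarith)
  have e : (f x - f (x / 2)) / (x - x / 2) * (x / 2) = f x - f (x / 2) := by
    field_simp; ring
  rw [e] at h2
  rw [div_lt_div_iff₀ (by linarith) (by linarith), hf1] at h
  have : (1 - x) * (f x - f (x/2)) < - f x * (x / 2) := by nlinarith
  have h4 : (1 - x) * (f (x / 2) - (f x - f (x / 2))) ≤ (1 - x) * a :=
    mul_le_mul_of_nonneg_left h2 (by linarith)
  nlinarith

/-- Bound for the part where `p ≥ q`. -/
lemma aux_up (hs : StrictConvexOn ℝ (Set.Ioi 0) f) (hf1 : f 1 = 0)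
    (hb : ∀ x y, 0 < x → x < y → (f y - f x) / (y - x) ≤ b) {p q : ℝ} (hq : 0 ≤ q) (hpq : q ≤ p) :
    auxTerm f a b p q ≤ b * (p - q) := by
  unfold auxTerm
  split_ifs with h1 h2
  · have : q = 0 := by linarith
    simp [h1, this]
  · simp [h2]
  · have hq' : 0 < q := lt_of_le_of_ne hq (Ne.symm h2)
    rcases hpq.eq_or_lt with h | h
    · rw [← h, div_self h2, hf1]; simp
    · have := aux_b_strict hs hf1 hb ((one_lt_div hq').2 h)
      have h5 := mul_le_mul_of_nonneg_left this.le hq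
      have e : q * (b * (p / q - 1)) = b * (p - q) := by field_simp
      linarith

lemma aux_down (hs : StrictConvexOn ℝ (Set.Ioi 0) f) (hf1 : f 1 = 0)
    (ha : ∀ x y, 0 < x → x < y → f x - (f y - f x) / (y - x) * x ≤ a) {p q : ℝ}
    (hp : 0 ≤ p) (hpq : p ≤ q) :
    auxTerm f a b p q ≤ a * (q - p) := by
  unfold auxTerm
  split_ifs with h1 h2
  · simp [h1]
  · exfalso; apply h1; linarith
  · have hp' : 0 < p := lt_of_le_of_ne hp (Ne.symm h1)
    have hq' : 0 < q := by linarith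
    rcases hpq.eq_or_lt with h | h
    · rw [h, div_self h2, hf1]; simp
    · have := aux_a_strict hs hf1 ha (div_pos hp' hq') ((div_lt_one hq').2 h)
      have h5 := mul_le_mul_of_nonneg_left this.le hq'.le
      have e : q * (a * (1 - p / q)) = a * (q - p) := by field_simp
      linarith

/-- Gap for the part where `p ≥ q`. -/
lemma aux_up_gap (hs : StrictConvexOn ℝ (Set.Ioi 0) f) (hf1 : f 1 = 0)
    (hb : ∀ x y, 0 < x → x < y → (f y - f x) / (y - x) ≤ b) {p q t c : ℝ} (ht : 0 < t)
    (hc : 0 < c) (hq : c ≤ q) (hq1 : q ≤ 1) (hpq : t ≤ p - q) :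
    auxTerm f a b p q ≤ b * (p - q) - c * (b * t - f (1 + t)) := by
  have hq' : 0 < q := by linarith
  have hp' : 0 < p := by linarith
  unfold auxTerm
  rw [if_neg hp'.ne', if_neg hq'.ne']
  have hx : 1 + t ≤ p / q := by
    rw [le_div_iff₀ hq']
    nlinarith
  have hm : f (p / q) - f (1 + t) ≤ b * (p / q - (1 + t)) := by
    rcases hx.eq_or_lt with h | h
    · rw [← h]; simp
    · have := hb (1 + t) (p / q) (by linarith) h
      rwa [div_le_iff₀ (by linarith)] at this
  have hpos := aux_b_strict hs hf1 hb (x := 1 + t) (by linarith)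
  have h5 := mul_le_mul_of_nonneg_left hm hq'.le
  have e : q * (b * (p / q - (1 + t))) = b * (p - q) - q * (b * t) := by field_simp; ring
  have h6 : c * (b * t - f (1 + t)) ≤ q * (b * t - f (1 + t)) :=
    mul_le_mul_of_nonneg_right hq (by linarith)
  linarith

lemma aux_down_gap (hs : StrictConvexOn ℝ (Set.Ioi 0) f) (hf1 : f 1 = 0)
    (ha : ∀ x y, 0 < x → x < y → f x - (f y - f x) / (y - x) * x ≤ a) {p q t c : ℝ} (ht : 0 < t)
    (ht1 : t < 1)
    (hc : 0 < c) (hp : c ≤ p) (hq1 : q ≤ 1) (hpq : t ≤ q - p) :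
    auxTerm f a b p q ≤ a * (q - p) - c * (a * t - f (1 - t)) := by
  have hp' : 0 < p := by linarith
  have hq' : 0 < q := by linarith
  unfold auxTerm
  rw [if_neg hp'.ne', if_neg hq'.ne']
  have hx0 : 0 < p / q := div_pos hp' hq'
  have hx : p / q ≤ 1 - t := by
    rw [div_le_iff₀ hq']
    nlinarith
  have hpos := aux_a_strict hs hf1 ha (x := 1 - t) (by linarith) (by linarith)
  -- `(1 - t) (f x - a) ≤ x (f (1 - t) - a)`
  have hm : (1 - t) * (f (p / q) - a) ≤ (p / q) * (f (1 - t) - a) := by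
    rcases hx.eq_or_lt with h | h
    · rw [← h]
    · have := ha (p / q) (1 - t) hx0 h
      have hd : 0 < 1 - t - p / q := by linarith
      set x := p / q
      have e : (f (1 - t) - f x) / (1 - t - x) * x = (f (1 - t) - f x) * x / (1 - t - x) := by
        ring
      rw [e, sub_le_iff_le_add, ← sub_le_iff_le_add', le_div_iff₀ hd] at this
      nlinarith
  -- multiply by `q`
  have h5 := mul_le_mul_of_nonneg_left hm hq'.le
  have e : q * (p / q * (f (1 - t) - a)) = p * (f (1 - t) - a) := by field_simp
  rw [e] at h5
  have h6 : c * (a * t - f (1 - t)) ≤ p * (a * t - f (1 - t)) :=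
    mul_le_mul_of_nonneg_right hp (by linarith)
  have h7 : (1 - t) * (q * f (p / q)) ≤ (1 - t) * (a * (q - p)) - p * (a * t - f (1 - t)) := by
    linarith
  have h8 : (1 - t) * (p * (a * t - f (1 - t))) ≤ p * (a * t - f (1 - t)) := by
    have : 0 ≤ p * (a * t - f (1 - t)) := mul_nonneg hp'.le (by linarith)
    nlinarith
  have h9 : (1 - t) * (q * f (p / q)) ≤ (1 - t) * (a * (q - p) - p * (a * t - f (1 - t))) := by
    linarith
  have h10 := le_of_mul_le_mul_left h9 (by linarith)
  linarith

lemma aux_ab_pos (hs : StrictConvexOn ℝ (Set.Ioi 0) f) (hf1 : f 1 = 0)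
    (ha : ∀ x y, 0 < x → x < y → f x - (f y - f x) / (y - x) * x ≤ a)
    (hb : ∀ x y, 0 < x → x < y → (f y - f x) / (y - x) ≤ b) : 0 < a + b := by
  have h1 := aux_a_strict hs hf1 ha (x := 1/2) (by norm_num) (by norm_num)
  have h2 := aux_b_strict hs hf1 hb (x := 3/2) (by norm_num)
  have h := hs.slope_strict_mono_adjacent (x := 1/2) (y := 1) (z := 3/2)
    (by norm_num : (0:ℝ) < 1/2) (by norm_num : (0:ℝ) < 3/2) (by norm_num) (by norm_num)
  rw [hf1, div_lt_div_iff₀ (by norm_num) (by norm_num)] at h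
  linarith

lemma aux_two (hs : StrictConvexOn ℝ (Set.Ioi 0) f) (hf1 : f 1 = 0)
    (ha : ∀ x y, 0 < x → x < y → f x - (f y - f x) / (y - x) * x ≤ a)
    (hb : ∀ x y, 0 < x → x < y → (f y - f x) / (y - x) ≤ b)
    {V : ℝ} (hV0 : 0 < V) (hV1 : V < 1) :
    ∃ M : ℝ, M < V * (a + b) ∧ ∀ p q, 0 ≤ q → q ≤ p → p ≤ 1 → p - q ≤ V →
      auxTerm f a b p q + auxTerm f a b (1 - p) (1 - q) ≤ M := by
  have hab := aux_ab_pos hs hf1 ha hb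
  have d1 := aux_b_strict hs hf1 hb (x := 1 + V / 2) (by linarith)
  have d2 := aux_a_strict hs hf1 ha (x := 1 - V / 2) (by linarith) (by linarith)
  have g1 : 0 < (1 - V) / 2 * (b * (V / 2) - f (1 + V / 2)) :=
    mul_pos (by linarith) (by linarith)
  have g2 : 0 < (1 - V) / 2 * (a * (V / 2) - f (1 - V / 2)) :=
    mul_pos (by linarith) (by linarith)
  refine ⟨max (V / 2 * (a + b)) (max (V * (a + b) - (1 - V) / 2 * (b * (V / 2) - f (1 + V / 2)))
    (V * (a + b) - (1 - V) / 2 * (a * (V / 2) - f (1 - V / 2)))), ?_, ?_⟩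
  · refine max_lt (by nlinarith) (max_lt (by linarith) (by linarith))
  · intro p q hq hqp hp hV
    have u := aux_up (a := a) hs hf1 hb hq hqp
    have d := aux_down (b := b) hs hf1 ha (p := 1 - p) (q := 1 - q) (by linarith) (by linarith)
    have hVab : (p - q) * (a + b) ≤ V * (a + b) := mul_le_mul_of_nonneg_right hV hab.le
    by_cases h : p - q ≤ V / 2
    · apply le_max_of_le_left
      have : (p - q) * (a + b) ≤ V / 2 * (a + b) := mul_le_mul_of_nonneg_right h hab.le
      linarith
    · push Not at h
      apply le_max_of_le_right
      by_cases h2 : (1 - V) / 2 ≤ q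
      · apply le_max_of_le_left
        have := aux_up_gap (a := a) hs hf1 hb (half_pos hV0) (by linarith) h2 (by linarith) h.le
        linarith
      · push Not at h2
        apply le_max_of_le_right
        have := aux_down_gap (b := b) hs hf1 ha (p := 1 - p) (q := 1 - q) (c := (1 - V) / 2)
          (half_pos hV0) (by linarith) (by linarith) (by linarith) (by linarith) (by linarith)
        linarith

end real

/-- **Section 4.3 (tightness).** For a strictly convex `f` generating a finite divergence, the
supremum of `D_f` over pairs of probability measures on three points with `V(P,Q) ≤ V` is
strictly larger than the same supremum over pairs on two points, for every `V ∈ (0,1)`. -/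
theorem tightness_three_points (f : ℝ → ℝ)
    (hf : ConvexOn ℝ (Set.Ioi 0) f) (hf1 : f 1 = 0)
    (hstrict : StrictConvexOn ℝ (Set.Ioi 0) f)
    (hfin : sSup {x : EReal | ∃ pp : PMPair, x = fDiv f pp.P pp.Q} < ⊤)
    (V : ℝ) (hV0 : 0 < V) (hV1 : V < 1) :
    sSup {x : EReal | ∃ P Q : Measure (Fin 2),
        IsProbabilityMeasure P ∧ IsProbabilityMeasure Q ∧
        tvDist P Q ≤ V ∧ x = fDiv f P Q} <
    sSup {x : EReal | ∃ P Q : Measure (Fin 3),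
        IsProbabilityMeasure P ∧ IsProbabilityMeasure Q ∧
        tvDist P Q ≤ V ∧ x = fDiv f P Q} := by
  obtain ⟨a, b, ha', hb'⟩ := aux_finite hf hfin
  have ha : ∀ x y, 0 < x → x < y → f x - (f y - f x) / (y - x) * x ≤ a := by
    intro x y hx hxy
    have := aux_le_limAtZero hf hx hxy
    rwa [ha', EReal.coe_le_coe_iff] at this
  have hb : ∀ x y, 0 < x → x < y → (f y - f x) / (y - x) ≤ b := by
    intro x y hx hxy
    have := aux_le_derivAtTop hf hx hxy
    rwa [hb', EReal.coe_le_coe_iff] at this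
  obtain ⟨M, hM, hM2⟩ := aux_two hstrict hf1 ha hb hV0 hV1
  apply lt_of_le_of_lt (b := ((M : ℝ) : EReal))
  · apply sSup_le
    rintro x ⟨P, Q, iP, iQ, htv, rfl⟩
    rw [aux_fDiv_real f a b ha' hb', EReal.coe_le_coe_iff, Fin.sum_univ_two]
    rw [aux_tv, Fin.sum_univ_two] at htv
    have sP : P.real {0} + P.real {1} = 1 := by
      have := aux_real_sum P Set.univ
      rw [probReal_univ, Fin.sum_univ_two] at this
      simp only [Set.mem_univ, if_true] at this
      exact this.symm
    have sQ : Q.real {0} + Q.real {1} = 1 := by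
      have := aux_real_sum Q Set.univ
      rw [probReal_univ, Fin.sum_univ_two] at this
      simp only [Set.mem_univ, if_true] at this
      exact this.symm
    have p0 : 0 ≤ P.real {0} := measureReal_nonneg
    have p1 : 0 ≤ P.real {1} := measureReal_nonneg
    have q0 : 0 ≤ Q.real {0} := measureReal_nonneg
    have q1 : 0 ≤ Q.real {1} := measureReal_nonneg
    generalize P.real {0} = x0 at *
    generalize P.real {1} = x1 at *
    generalize Q.real {0} = y0 at *
    generalize Q.real {1} = y1 at *
    rcases le_total y0 x0 with h | h
    · rw [abs_of_nonneg (by linarith), abs_of_nonpos (by linarith)] at htv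
      obtain rfl : x1 = 1 - x0 := by linarith
      obtain rfl : y1 = 1 - y0 := by linarith
      exact hM2 x0 y0 q0 h (by linarith) (by linarith)
    · rw [abs_of_nonpos (by linarith), abs_of_nonneg (by linarith)] at htv
      obtain rfl : x0 = 1 - x1 := by linarith
      obtain rfl : y0 = 1 - y1 := by linarith
      rw [add_comm]
      exact hM2 x1 y1 q1 (by linarith) (by linarith) (by linarith)
  · apply lt_of_lt_of_le (EReal.coe_lt_coe_iff.2 hM)
    apply le_sSup
    have hp : ∀ i, 0 ≤ (![V, 1 - V, 0] : Fin 3 → ℝ) i := by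
      intro i; fin_cases i <;> simp <;> linarith
    have hq : ∀ i, 0 ≤ (![0, 1 - V, V] : Fin 3 → ℝ) i := by
      intro i; fin_cases i <;> simp <;> linarith
    have i1 : IsProbabilityMeasure (auxM (![V, 1 - V, 0] : Fin 3 → ℝ)) :=
      auxM_prob _ hp (by simp [Fin.sum_univ_three])
    have i2 : IsProbabilityMeasure (auxM (![0, 1 - V, V] : Fin 3 → ℝ)) :=
      auxM_prob _ hq (by simp [Fin.sum_univ_three])
    refine ⟨_, _, i1, i2, ?_, ?_⟩
    · rw [aux_tv]
      simp [Fin.sum_univ_three, auxM_real _ hp, auxM_real _ hq, abs_of_pos hV0]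
    · rw [aux_fDiv_real f a b ha' hb', EReal.coe_eq_coe_iff]
      have hV : 1 - V ≠ 0 := by linarith
      simp [Fin.sum_univ_three, auxM_real _ hp, auxM_real _ hq, auxTerm, hV0.ne', hV, hf1]
      ring

end
end

section
/- Let D_f be an arbitrary f-divergence and suppose each of D_{f_1},…,D_{f_m} is a primitive divergence, i.e. f_i = u_{s_i} for some s_i > 0 where u_s(t) := min(1,s) − min(t,s). Then for all D_1,…,D_m ≥ 0, B(D_1,…,D_m) = B_{m+1}(D_1,…,D_m); that is, the infimum of D_f(P‖Q) subject to D_{f_i}(P‖Q) ≥ D_i for all i, over all pairs of probability measures on all measurable spaces, equals the same infimum restricted to pairs of probability measures on the finite set {1,…,m+1}. -/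
open MeasureTheory Filter Set
open scoped ENNReal NNReal Classical

noncomputable section

section Helpers

variable {Ω : Type*} [MeasurableSpace Ω]

lemma aux_support {f : ℝ → ℝ} (hf : ConvexOn ℝ (Set.Ioi 0) f) {t : ℝ} (ht : 0 < t) :
    ∃ a b : ℝ, (∀ x, 0 < x → a + b * x ≤ f x) ∧ a + b * t = f t := by
  have hti : t ∈ interior (Set.Ioi (0:ℝ)) := by simpa using ht
  set b := derivWithin f (Ioi t) t with hb
  refine ⟨f t - b * t, b, ?_, by ring⟩
  intro x hx
  rcases lt_trichotomy t x with h | h | h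
  · have h1 := hf.rightDeriv_le_slope_of_mem_interior hti hx h
    rw [slope_def_field, le_div_iff₀ (by linarith)] at h1
    rw [← hb] at h1
    nlinarith
  · subst h; linarith
  · have h1 := (hf.slope_le_leftDeriv_of_mem_interior hx hti h).trans
      (hf.leftDeriv_le_rightDeriv_of_mem_interior hti)
    rw [slope_def_field, div_le_iff₀ (by linarith)] at h1
    rw [← hb] at h1
    nlinarith

lemma aux_lim_zero {f : ℝ → ℝ} {a b : ℝ} (h : ∀ x, 0 < x → a + b * x ≤ f x) :
    (a : EReal) ≤ limAtZero f := by
  have ht : Tendsto (fun x : ℝ => ((a + b * x : ℝ) : EReal)) (nhdsWithin 0 (Set.Ioi 0))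
      (nhds (a : EReal)) := by
    apply (continuous_coe_real_ereal.tendsto a).comp
    have : Continuous fun x : ℝ => a + b * x := by fun_prop
    have h2 := this.tendsto 0
    simp only [mul_zero, add_zero] at h2
    exact h2.mono_left nhdsWithin_le_nhds
  rw [← ht.limsup_eq]
  refine Filter.limsup_le_limsup ?_
  filter_upwards [self_mem_nhdsWithin] with x hx
  exact EReal.coe_le_coe_iff.2 (h x hx)

lemma aux_lim_top {f : ℝ → ℝ} {a b : ℝ} (h : ∀ x, 0 < x → a + b * x ≤ f x) :
    (b : EReal) ≤ derivAtTop f := by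
  have ht : Tendsto (fun x : ℝ => ((a / x + b : ℝ) : EReal)) atTop
      (nhds (b : EReal)) := by
    apply (continuous_coe_real_ereal.tendsto b).comp
    have h2 := (tendsto_const_nhds (x := a)).div_atTop (tendsto_id (α := ℝ) (x := atTop))
    simpa using h2.add_const b
  rw [← ht.limsup_eq]
  refine Filter.limsup_le_limsup ?_
  filter_upwards [eventually_gt_atTop 0] with x hx
  refine EReal.coe_le_coe_iff.2 ?_
  rw [le_div_iff₀ hx]
  have := h x hx
  have e : (a / x + b) * x = a + b * x := by field_simp
  rw [e]; exact this

/-- The integrand with a real value at ratio zero. -/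
def gfun (f : ℝ → ℝ) (c0 : ℝ) (P Q : Measure Ω) (x : Ω) : ℝ :=
  if Measure.rnDeriv P Q x = 0 then c0 else f ((Measure.rnDeriv P Q x).toReal)

lemma aux_meas0 (P Q : Measure Ω) : MeasurableSet {x | Measure.rnDeriv P Q x = 0} :=
  measurableSet_eq_fun (Measure.measurable_rnDeriv P Q) measurable_const

lemma aux_g {f : ℝ → ℝ} {c0 : ℝ} {P Q : Measure Ω} [IsProbabilityMeasure Q]
    (hi : Integrable (fun x => f ((Measure.rnDeriv P Q x).toReal))
      (Q.restrict {x | Measure.rnDeriv P Q x ≠ 0})) :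
    Integrable (gfun f c0 P Q) Q ∧ ∫ x, gfun f c0 P Q x ∂Q =
      ∫ x in {x | Measure.rnDeriv P Q x ≠ 0}, f ((Measure.rnDeriv P Q x).toReal) ∂Q
       + c0 * Q.real {x | Measure.rnDeriv P Q x = 0} := by
  have hm := aux_meas0 P Q
  set S := {x | Measure.rnDeriv P Q x = 0} with hS
  have hc : {x | Measure.rnDeriv P Q x ≠ 0} = Sᶜ := rfl
  rw [hc] at hi ⊢
  have e1 : EqOn (gfun f c0 P Q) (fun _ => c0) S := fun x hx => if_pos hx
  have e2 : EqOn (gfun f c0 P Q) (fun x => f ((Measure.rnDeriv P Q x).toReal)) Sᶜ :=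
    fun x hx => if_neg hx
  have i1 : IntegrableOn (gfun f c0 P Q) S Q :=
    (integrableOn_congr_fun e1 hm).2 (integrable_const c0)
  have i2 : IntegrableOn (gfun f c0 P Q) Sᶜ Q :=
    (integrableOn_congr_fun e2 hm.compl).2 hi
  have i : Integrable (gfun f c0 P Q) Q := by
    rw [← integrableOn_univ, ← union_compl_self S]; exact i1.union i2
  refine ⟨i, ?_⟩
  rw [← integral_add_compl hm i, setIntegral_congr_fun hm e1, setIntegral_congr_fun hm.compl e2,
    setIntegral_const, smul_eq_mul]
  ring

lemma aux_mul {c : EReal} {r : ℝ} {e : ℝ≥0∞} (he : e ≠ ⊤) (h : c = r ∨ e = 0) :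
    c * (e : EReal) = ((r * e.toReal : ℝ) : EReal) := by
  lift e to ℝ≥0 using he
  rcases h with h | h
  · subst h; rw [EReal.coe_mul]; rfl
  · simp [h]

lemma aux_fDiv_s13 {f : ℝ → ℝ} {c0 c1 : ℝ} {P Q : Measure Ω} [IsProbabilityMeasure P]
    [IsProbabilityMeasure Q]
    (hi : Integrable (fun x => f ((Measure.rnDeriv P Q x).toReal))
      (Q.restrict {x | Measure.rnDeriv P Q x ≠ 0}))
    (h0 : limAtZero f = c0 ∨ Q {x | Measure.rnDeriv P Q x = 0} = 0)
    (h1 : derivAtTop f = c1 ∨ P.singularPart Q univ = 0) :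
    fDiv f P Q = ((∫ x, gfun f c0 P Q x ∂Q + c1 * (P.singularPart Q).real univ : ℝ) : EReal) := by
  unfold fDiv
  rw [if_pos hi, aux_mul (measure_ne_top _ _) h0, aux_mul (measure_ne_top _ _) h1,
    (aux_g hi).2]
  norm_cast

/-- `P A = ∫_A r dQ + σ A`. -/
lemma aux_decomp_s13 (P Q : Measure Ω) [IsProbabilityMeasure P] [IsProbabilityMeasure Q] {A : Set Ω} :
    ∫ x in A, (Measure.rnDeriv P Q x).toReal ∂Q + (P.singularPart Q).real A = P.real A := by
  rw [Measure.setIntegral_toReal_rnDeriv_eq_withDensity]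
  conv_rhs => rw [← Measure.rnDeriv_add_singularPart P Q]
  rw [measureReal_add_apply]

lemma aux_rzero (P Q : Measure Ω) [IsProbabilityMeasure P] [IsProbabilityMeasure Q] {A : Set Ω}
    (hA : MeasurableSet A) (h : P A = 0) : ∀ᵐ x ∂Q, x ∈ A → Measure.rnDeriv P Q x = 0 := by
  have h1 := Measure.setLIntegral_rnDeriv_le (μ := P) (ν := Q) A
  rw [h, nonpos_iff_eq_zero, lintegral_eq_zero_iff (Measure.measurable_rnDeriv P Q)] at h1
  exact (ae_restrict_iff' hA).1 h1


lemma aux_r_int (P Q : Measure Ω) [IsProbabilityMeasure P] :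
    Integrable (fun x => (Measure.rnDeriv P Q x).toReal) Q :=
  Measure.integrable_toReal_rnDeriv

lemma aux_min_int (P Q : Measure Ω) [IsProbabilityMeasure P] [IsProbabilityMeasure Q] (s : ℝ) :
    Integrable (fun x => min (Measure.rnDeriv P Q x).toReal s) Q :=
  (aux_r_int P Q).inf (integrable_const s)

lemma aux_prim (P Q : Measure Ω) [IsProbabilityMeasure P] [IsProbabilityMeasure Q] {s : ℝ}
    (hs : 0 < s) :
    fDiv (fun t => min 1 s - min t s) P Q =
      ((min 1 s - ∫ x, min (Measure.rnDeriv P Q x).toReal s ∂Q : ℝ) : EReal) := by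
  have h0 : limAtZero (fun t => min 1 s - min t s) = ((min 1 s : ℝ) : EReal) := by
    apply Tendsto.limsup_eq
    apply (continuous_coe_real_ereal.tendsto _).comp
    have : Continuous fun t : ℝ => min 1 s - min t s := by fun_prop
    have h2 := this.tendsto 0
    rw [min_eq_left hs.le, sub_zero] at h2
    exact h2.mono_left nhdsWithin_le_nhds
  have h1 : derivAtTop (fun t => min 1 s - min t s) = ((0 : ℝ) : EReal) := by
    apply Tendsto.limsup_eq
    apply (continuous_coe_real_ereal.tendsto _).comp
    have h2 := (tendsto_const_nhds (x := min 1 s - s)).div_atTop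
      (tendsto_id (α := ℝ) (x := atTop))
    refine h2.congr' ?_
    filter_upwards [eventually_ge_atTop s] with x hx
    rw [min_eq_right hx, id]
  have hi : Integrable (fun x => min 1 s - min (Measure.rnDeriv P Q x).toReal s) Q :=
    (integrable_const _).sub (aux_min_int P Q s)
  rw [aux_fDiv_s13 hi.restrict (Or.inl h0) (Or.inl h1)]
  congr 1
  have : gfun (fun t => min 1 s - min t s) (min 1 s) P Q =
      fun x => min 1 s - min (Measure.rnDeriv P Q x).toReal s := by
    funext x
    unfold gfun
    split_ifs with h
    · simp [h, hs.le]
    · rfl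
  rw [this, integral_sub (integrable_const _) (aux_min_int P Q s)]
  simp

lemma aux_prim_le (P Q : Measure Ω) [IsProbabilityMeasure P] [IsProbabilityMeasure Q] {s : ℝ}
    {A : Set Ω} (hA : MeasurableSet A) :
    ∫ x, min (Measure.rnDeriv P Q x).toReal s ∂Q ≤ P.real A + s * Q.real Aᶜ := by
  have hi := aux_min_int P Q s
  rw [← integral_add_compl hA hi]
  have h1 : ∫ x in A, min (Measure.rnDeriv P Q x).toReal s ∂Q ≤
      ∫ x in A, (Measure.rnDeriv P Q x).toReal ∂Q :=
    integral_mono hi.restrict (aux_r_int P Q).restrict fun x => min_le_left _ _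
  have h2 : ∫ x in Aᶜ, min (Measure.rnDeriv P Q x).toReal s ∂Q ≤ ∫ x in Aᶜ, s ∂Q :=
    integral_mono hi.restrict (integrable_const s) fun x => min_le_right _ _
  rw [setIntegral_const, smul_eq_mul] at h2
  have h3 := aux_decomp_s13 P Q (A := A)
  have h4 : 0 ≤ (P.singularPart Q).real A := measureReal_nonneg
  linarith

lemma aux_prim_eq (P Q : Measure Ω) [IsProbabilityMeasure P] [IsProbabilityMeasure Q] {s : ℝ}
    (hs : 0 < s) {N A : Set Ω} (hA : MeasurableSet A) (hN : Q N = 0)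
    (hN' : P.singularPart Q Nᶜ = 0)
    (hA' : A = {x | x ∉ N ∧ Measure.rnDeriv P Q x < ENNReal.ofReal s}) :
    P.real A + s * Q.real Aᶜ = ∫ x, min (Measure.rnDeriv P Q x).toReal s ∂Q := by
  have hi := aux_min_int P Q s
  rw [← integral_add_compl hA hi]
  have h1 : ∫ x in A, min (Measure.rnDeriv P Q x).toReal s ∂Q =
      ∫ x in A, (Measure.rnDeriv P Q x).toReal ∂Q := by
    apply setIntegral_congr_fun hA
    intro x hx
    rw [hA'] at hx
    apply min_eq_left
    exact ENNReal.toReal_le_of_le_ofReal hs.le hx.2.le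
  have h2 : ∫ x in Aᶜ, min (Measure.rnDeriv P Q x).toReal s ∂Q = ∫ x in Aᶜ, s ∂Q := by
    apply setIntegral_congr_ae hA.compl
    have hN2 : ∀ᵐ x ∂Q, x ∉ N := measure_eq_zero_iff_ae_notMem.1 hN
    filter_upwards [hN2, Measure.rnDeriv_ne_top P Q] with x hx hx' hxA
    apply min_eq_right
    rw [hA'] at hxA
    simp only [mem_compl_iff, mem_ofPred_eq, not_and, not_lt] at hxA
    exact (ENNReal.ofReal_le_iff_le_toReal hx').1 (hxA hx)
  rw [setIntegral_const, smul_eq_mul] at h2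
  have h3 := aux_decomp_s13 P Q (A := A)
  have h4 : (P.singularPart Q).real A = 0 := by
    have : P.singularPart Q A = 0 := measure_mono_null (fun x hx => by
      rw [hA'] at hx; exact hx.1) hN'
    simp [measureReal_def, this]
  linarith

lemma aux_fin {n : ℕ} (P Q : Measure (Fin n)) [IsProbabilityMeasure P] [IsProbabilityMeasure Q]
    (j : Fin n) :
    (Q {j} = 0 → P.singularPart Q {j} = P {j}) ∧
    (Q {j} ≠ 0 → P.singularPart Q {j} = 0 ∧ Measure.rnDeriv P Q j * Q {j} = P {j}) := by
  have h : P {j} = P.singularPart Q {j} + Measure.rnDeriv P Q j * Q {j} := by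
    conv_lhs => rw [← Measure.singularPart_add_rnDeriv P Q]
    rw [Measure.add_apply, withDensity_apply _ (measurableSet_singleton j),
      lintegral_singleton]
  refine ⟨fun hq => by rw [h, hq]; simp, fun hq => ?_⟩
  have hs : P.singularPart Q {j} = 0 := by
    obtain ⟨S, hS, h1, h2⟩ := Measure.mutuallySingular_singularPart P Q
    have : j ∈ S := by
      by_contra hj
      exact hq (measure_mono_null (by simpa using hj) h2)
    exact measure_mono_null (by simpa using this) h1
  exact ⟨hs, by rw [h, hs, zero_add]⟩

/-- Data processing for maps to a finite set. -/
lemma aux_dpi {f : ℝ → ℝ} (hf : ConvexOn ℝ (Set.Ioi 0) f) {n : ℕ} (P Q : Measure Ω)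
    [IsProbabilityMeasure P] [IsProbabilityMeasure Q] {T : Ω → Fin n} (hT : Measurable T) :
    fDiv f (P.map T) (Q.map T) ≤ fDiv f P Q := by
  have : IsProbabilityMeasure (P.map T) := Measure.isProbabilityMeasure_map hT.aemeasurable
  have : IsProbabilityMeasure (Q.map T) := Measure.isProbabilityMeasure_map hT.aemeasurable
  set P' := P.map T with hP'
  set Q' := Q.map T with hQ'
  by_cases htop : fDiv f P Q = ⊤
  · rw [htop]; exact le_top
  obtain ⟨a, b, hab, -⟩ := aux_support hf one_pos
  have hz := aux_lim_zero hab
  have ht := aux_lim_top hab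
  have hz' : limAtZero f ≠ ⊥ := fun h => by simp [h] at hz
  have ht' : derivAtTop f ≠ ⊥ := fun h => by simp [h] at ht
  have bot_mul : ∀ (c : EReal) (e : ℝ≥0∞), c ≠ ⊥ → e ≠ ⊤ → c * (e : EReal) ≠ ⊥ := by
    intro c e hc he
    lift e to ℝ≥0 using he
    induction c with
    | bot => exact absurd rfl hc
    | coe r =>
      rw [aux_mul ENNReal.coe_ne_top (Or.inl rfl)]; exact EReal.coe_ne_bot _
    | top =>
      rcases eq_or_ne e 0 with h | h
      · simp [h]
      · rw [EReal.top_mul_of_pos (by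
          have : (0:ℝ≥0∞) < e := by simpa using pos_iff_ne_zero.2 h
          exact_mod_cast this)]
        simp
  have key : Integrable (fun x => f ((Measure.rnDeriv P Q x).toReal))
      (Q.restrict {x | Measure.rnDeriv P Q x ≠ 0}) ∧
      (limAtZero f = ⊤ → Q {x | Measure.rnDeriv P Q x = 0} = 0) ∧
      (derivAtTop f = ⊤ → P.singularPart Q univ = 0) := by
    have b1 := bot_mul _ _ hz' (measure_ne_top Q {x | Measure.rnDeriv P Q x = 0})
    have b2 := bot_mul _ _ ht' (measure_ne_top (P.singularPart Q) univ)
    unfold fDiv at htop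
    have b3 : (if Integrable (fun x => f ((Measure.rnDeriv P Q x).toReal))
      (Q.restrict {x | Measure.rnDeriv P Q x ≠ 0})
      then ((∫ x in {x | Measure.rnDeriv P Q x ≠ 0},
       f ((Measure.rnDeriv P Q x).toReal) ∂Q : ℝ) : EReal)
      else (⊤ : EReal)) ≠ ⊥ := by split_ifs <;> simp
    refine ⟨?_, ?_, ?_⟩
    · by_contra h
      rw [if_neg h, EReal.top_add_of_ne_bot b1, EReal.top_add_of_ne_bot b2] at htop
      exact htop rfl
    · intro h
      by_contra h'
      rw [h, EReal.top_mul_of_pos (by exact_mod_cast pos_iff_ne_zero.2 h'),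
        EReal.add_top_of_ne_bot b3, EReal.top_add_of_ne_bot b2] at htop
      exact htop rfl
    · intro h
      by_contra h'
      rw [h, EReal.top_mul_of_pos (by exact_mod_cast pos_iff_ne_zero.2 h'),
        EReal.add_top_of_ne_bot] at htop
      · exact htop rfl
      · rw [ne_eq, EReal.add_eq_bot_iff]
        tauto
  obtain ⟨hi, k0, k1⟩ := key
  set c0 := (limAtZero f).toReal with hc0
  set c1 := (derivAtTop f).toReal with hc1
  have d0 : limAtZero f = c0 ∨ limAtZero f = ⊤ := by
    by_cases h : limAtZero f = ⊤
    · exact Or.inr h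
    · exact Or.inl (EReal.coe_toReal h hz').symm
  have d1 : derivAtTop f = c1 ∨ derivAtTop f = ⊤ := by
    by_cases h : derivAtTop f = ⊤
    · exact Or.inr h
    · exact Or.inl (EReal.coe_toReal h ht').symm
  have mA : ∀ j : Fin n, MeasurableSet (T ⁻¹' {j}) := fun j => hT (measurableSet_singleton j)
  have eP : ∀ j, P' {j} = P (T ⁻¹' {j}) := fun j => Measure.map_apply hT (measurableSet_singleton j)
  have eQ : ∀ j, Q' {j} = Q (T ⁻¹' {j}) := fun j => Measure.map_apply hT (measurableSet_singleton j)
  -- facts about cells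
  have sing_cell : ∀ j, Q' {j} = 0 → P'.singularPart Q' {j} = P.singularPart Q (T ⁻¹' {j}) := by
    intro j hj
    rw [(aux_fin P' Q' j).1 hj, eP]
    conv_lhs => rw [← Measure.singularPart_add_rnDeriv P Q]
    rw [Measure.add_apply, withDensity_absolutelyContinuous Q _ ((eQ j).symm.trans hj), add_zero]
  have e0 : limAtZero f = c0 ∨ Q' {x | Measure.rnDeriv P' Q' x = 0} = 0 := by
    refine d0.imp_right fun h => ?_
    rw [← Measure.tsum_indicator_apply_singleton Q' _ (aux_meas0 P' Q'), ENNReal.tsum_eq_zero]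
    intro j
    by_cases hj : Measure.rnDeriv P' Q' j = 0
    · rw [indicator_of_mem (by exact hj)]
      by_contra hq
      have hp := ((aux_fin P' Q' j).2 hq).2
      rw [hj, zero_mul, eP] at hp
      have h2 := aux_rzero P Q (mA j) hp.symm
      have h3 : Q (T ⁻¹' {j}) ≤ Q {x | Measure.rnDeriv P Q x = 0} := measure_mono_ae h2
      rw [k0 h, ← eQ] at h3
      exact hq (nonpos_iff_eq_zero.1 h3)
    · exact indicator_of_notMem (by exact hj) _
  have e1 : derivAtTop f = c1 ∨ P'.singularPart Q' univ = 0 := by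
    refine d1.imp_right fun h => ?_
    rw [← Measure.tsum_indicator_apply_singleton _ _ MeasurableSet.univ, ENNReal.tsum_eq_zero]
    intro j
    rw [indicator_of_mem (mem_univ j)]
    by_cases hq : Q' {j} = 0
    · rw [sing_cell j hq]
      exact measure_mono_null (subset_univ _) (k1 h)
    · exact ((aux_fin P' Q' j).2 hq).1
  have hi' : Integrable (fun x => f ((Measure.rnDeriv P' Q' x).toReal))
      (Q'.restrict {x | Measure.rnDeriv P' Q' x ≠ 0}) := Integrable.of_finite
  rw [aux_fDiv_s13 hi' e0 e1, aux_fDiv_s13 hi (d0.imp_right k0) (d1.imp_right k1), EReal.coe_le_coe_iff]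
  have ig := (aux_g (c0 := c0) hi).1
  have hU : (⋃ j, T ⁻¹' {j}) = univ := by
    ext x; simp
  have hdisj : Pairwise (Function.onFun Disjoint fun j => T ⁻¹' {j}) := by
    intro i j hij
    exact Disjoint.preimage _ (by simpa using hij)
  have s1 : ∫ x, gfun f c0 P Q x ∂Q = ∑ j, ∫ x in T ⁻¹' {j}, gfun f c0 P Q x ∂Q := by
    rw [← integral_iUnion_fintype mA hdisj (fun j => ig.integrableOn), hU, setIntegral_univ]
  have s2 : (P.singularPart Q).real univ = ∑ j, (P.singularPart Q).real (T ⁻¹' {j}) := by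
    rw [← measureReal_iUnion_fintype hdisj mA, hU]
  have s3 : ∫ x, gfun f c0 P' Q' x ∂Q' = ∑ j, Q'.real {j} * gfun f c0 P' Q' j := by
    rw [integral_fintype Integrable.of_finite]; simp
  have s4 : (P'.singularPart Q').real univ = ∑ j, (P'.singularPart Q').real {j} := by
    rw [← Finset.coe_univ, sum_measureReal_singleton]
  rw [s1, s2, s3, s4, Finset.mul_sum, Finset.mul_sum, ← Finset.sum_add_distrib,
    ← Finset.sum_add_distrib]
  apply Finset.sum_le_sum
  intro j _
  have rQ : Q'.real {j} = Q.real (T ⁻¹' {j}) := by simp [measureReal_def, eQ]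
  have rP : P'.real {j} = P.real (T ⁻¹' {j}) := by simp [measureReal_def, eP]
  have hdec := aux_decomp_s13 P Q (A := T ⁻¹' {j})
  by_cases hq : Q' {j} = 0
  · have hq2 : Q (T ⁻¹' {j}) = 0 := (eQ j).symm.trans hq
    rw [setIntegral_measure_zero _ hq2]
    simp [measureReal_def, hq, sing_cell j hq]
  obtain ⟨g1, g2⟩ := (aux_fin P' Q' j).2 hq
  have g1' : (P'.singularPart Q').real {j} = 0 := by simp [measureReal_def, g1]
  rw [g1', mul_zero, add_zero]
  by_cases hp : P' {j} = 0
  · have hr : Measure.rnDeriv P' Q' j = 0 := by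
      rw [hp] at g2; exact (mul_eq_zero.1 g2).resolve_right hq
    have hp2 := (eP j).symm.trans hp
    have z : (P.singularPart Q).real (T ⁻¹' {j}) = 0 := by
      have := Measure.singularPart_le P Q (T ⁻¹' {j})
      rw [hp2, nonpos_iff_eq_zero] at this
      simp [measureReal_def, this]
    have hg : ∫ x in T ⁻¹' {j}, gfun f c0 P Q x ∂Q = ∫ x in T ⁻¹' {j}, c0 ∂Q := by
      apply setIntegral_congr_ae (mA j)
      filter_upwards [aux_rzero P Q (mA j) hp2] with x hx hxA
      simp [gfun, hx hxA]
    rw [hg, z, setIntegral_const, smul_eq_mul, rQ]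
    simp [gfun, hr]
  · have hr : Measure.rnDeriv P' Q' j ≠ 0 := fun h => by
      rw [h, zero_mul] at g2; exact hp g2.symm
    have hr2 : Measure.rnDeriv P' Q' j ≠ ⊤ := fun h => by
      rw [h, ENNReal.top_mul hq] at g2; exact measure_ne_top _ _ g2.symm
    set t := (Measure.rnDeriv P' Q' j).toReal with htdef
    have tpos : 0 < t := ENNReal.toReal_pos hr hr2
    have hg : gfun f c0 P' Q' j = f t := if_neg hr
    have g3 : t * Q'.real {j} = P'.real {j} := by
      rw [measureReal_def, measureReal_def, ← g2, ENNReal.toReal_mul]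
    obtain ⟨a, b, hab, habt⟩ := aux_support hf tpos
    have l1 : ∫ x in T ⁻¹' {j}, (a + b * (Measure.rnDeriv P Q x).toReal) ∂Q ≤
        ∫ x in T ⁻¹' {j}, gfun f c0 P Q x ∂Q := by
      apply integral_mono_ae
      · exact ((integrable_const a).add ((aux_r_int P Q).const_mul b)).restrict
      · exact ig.restrict
      apply ae_restrict_of_ae
      have hae : ∀ᵐ x ∂Q, Measure.rnDeriv P Q x = 0 → a ≤ c0 := by
        rcases d0 with h | h
        · have := aux_lim_zero hab
          rw [h, EReal.coe_le_coe_iff] at this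
          exact Eventually.of_forall fun _ _ => this
        · have := measure_eq_zero_iff_ae_notMem.1 (k0 h)
          filter_upwards [this] with x hx hx'
          exact absurd hx' hx
      filter_upwards [hae, Measure.rnDeriv_ne_top P Q] with x h1 h2
      unfold gfun
      split_ifs with h
      · simpa [h] using h1 h
      · exact hab _ (ENNReal.toReal_pos h h2)
    rw [integral_add (integrable_const a) ((aux_r_int P Q).const_mul b).restrict,
      integral_const_mul, setIntegral_const, smul_eq_mul] at l1
    have l2 : b * (P.singularPart Q).real (T ⁻¹' {j}) ≤
        c1 * (P.singularPart Q).real (T ⁻¹' {j}) := by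
      rcases d1 with h | h
      · have := aux_lim_top hab
        rw [h, EReal.coe_le_coe_iff] at this
        exact mul_le_mul_of_nonneg_right this measureReal_nonneg
      · have : P.singularPart Q (T ⁻¹' {j}) = 0 := measure_mono_null (subset_univ _) (k1 h)
        simp [measureReal_def, this]
    rw [hg, ← habt]
    rw [rP] at g3
    rw [rQ] at g3 ⊢
    linear_combination l1 + l2 + b * g3 - b * hdec

end Helpers

/-- **Theorem 5 (primitive divergences).** If all the constraint divergences are primitive
divergences `D_{u_{s_i}}` with `u_s(t) = min(1,s) - min(t,s)`, then
`B(D_1,…,D_m) = B_{m+1}(D_1,…,D_m)`: the infimum of `D_f` subject to `D_{u_{s_i}}(P‖Q) ≥ D_i`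
over all pairs of probability measures equals the same infimum over pairs of probability
measures on a set with `m + 1` points. -/
theorem inf_primitive_constraints_reduction (m : ℕ) (f : ℝ → ℝ)
    (hf : ConvexOn ℝ (Set.Ioi 0) f) (hf1 : f 1 = 0)
    (sv : Fin m → ℝ) (hsv : ∀ i, 0 < sv i)
    (D : Fin m → ℝ) (hD : ∀ i, 0 ≤ D i) :
    sInf {x : EReal | ∃ pp : PMPair,
        (∀ i, (D i : EReal) ≤ fDiv (fun t => min 1 (sv i) - min t (sv i)) pp.P pp.Q) ∧
        x = fDiv f pp.P pp.Q} =
    sInf {x : EReal | ∃ P Q : Measure (Fin (m + 1)),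
        IsProbabilityMeasure P ∧ IsProbabilityMeasure Q ∧
        (∀ i, (D i : EReal) ≤ fDiv (fun t => min 1 (sv i) - min t (sv i)) P Q) ∧
        x = fDiv f P Q} := by
  apply le_antisymm
  · apply sInf_le_sInf
    rintro x ⟨P, Q, hP, hQ, h, hx⟩
    exact ⟨⟨Fin (m + 1), inferInstance, P, Q, hP, hQ⟩, h, hx⟩
  · apply le_sInf
    rintro x ⟨⟨Ω, iΩ, P, Q, hP, hQ⟩, h, rfl⟩
    dsimp only at h ⊢
    obtain ⟨S, hS, hS1, hS2⟩ := Measure.mutuallySingular_singularPart P Q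
    have hN : MeasurableSet Sᶜ := hS.compl
    set A : Fin m → Set Ω :=
      fun i => {x | x ∉ Sᶜ ∧ Measure.rnDeriv P Q x < ENNReal.ofReal (sv i)} with hAdef
    have mA : ∀ i, MeasurableSet (A i) := fun i =>
      hN.compl.inter (measurableSet_lt (Measure.measurable_rnDeriv P Q) measurable_const)
    have hmono : ∀ i k, sv i ≤ sv k → A i ⊆ A k := fun i k hik x hx =>
      ⟨hx.1, hx.2.trans_le (ENNReal.ofReal_le_ofReal hik)⟩
    set c : Ω → ℕ := fun x => ∑ i, (A i)ᶜ.indicator (fun _ => 1) x with hc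
    have mc : Measurable c :=
      Finset.measurable_sum _ fun i _ => measurable_const.indicator (mA i).compl
    have cle : ∀ x, c x < m + 1 := by
      intro x
      have : c x ≤ ∑ i : Fin m, 1 := Finset.sum_le_sum fun i _ => indicator_le_self' (by simp) x
      simp at this
      omega
    set T : Ω → Fin (m + 1) := fun x => Fin.ofNat (m + 1) (c x) with hT
    have mT : Measurable T := (measurable_from_nat (f := Fin.ofNat (m + 1))).comp mc
    have Tval : ∀ x, (T x : ℕ) = c x := fun x => Nat.mod_eq_of_lt (cle x)
    have cc : ∀ x, c x = (Finset.univ.filter fun k => x ∉ A k).card := by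
      intro x
      rw [Finset.card_filter]
      exact Finset.sum_congr rfl fun i _ => by simp [indicator_apply]
    have hpre : ∀ i, T ⁻¹' {j | (j : ℕ) ≤ (Finset.univ.filter fun k => sv k < sv i).card} = A i := by
      intro i
      ext x
      change (T x : ℕ) ≤ _ ↔ _
      rw [Tval, cc]
      constructor
      · intro hle
        by_contra hx
        have : (Finset.univ.filter fun k => sv k < sv i).card <
            (Finset.univ.filter fun k => x ∉ A k).card := by
          apply Finset.card_lt_card
          refine (Finset.ssubset_iff_of_subset ?_).2 ⟨i, by simpa using hx, by simp⟩
          intro k hk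
          simp only [Finset.mem_filter, Finset.mem_univ, true_and] at hk ⊢
          exact fun hxk => hx (hmono k i hk.le hxk)
        omega
      · intro hx
        apply Finset.card_le_card
        intro k hk
        simp only [Finset.mem_filter, Finset.mem_univ, true_and] at hk ⊢
        by_contra hlt
        exact hk (hmono i k (not_lt.1 hlt) hx)
    have iP : IsProbabilityMeasure (P.map T) := Measure.isProbabilityMeasure_map mT.aemeasurable
    have iQ : IsProbabilityMeasure (Q.map T) := Measure.isProbabilityMeasure_map mT.aemeasurable
    refine le_trans ?_ (aux_dpi hf P Q mT)
    apply sInf_le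
    refine ⟨P.map T, Q.map T, iP, iQ, fun i => (h i).trans ?_, rfl⟩
    rw [aux_prim P Q (hsv i), aux_prim (P.map T) (Q.map T) (hsv i), EReal.coe_le_coe_iff]
    have mB : MeasurableSet {j : Fin (m + 1) |
        (j : ℕ) ≤ (Finset.univ.filter fun k => sv k < sv i).card} := Set.Finite.measurableSet (Set.toFinite _)
    have h1 := aux_prim_le (P.map T) (Q.map T) (s := sv i) mB
    have h2 := aux_prim_eq P Q (hsv i) (mA i) hS2 (by rwa [compl_compl]) rfl
    rw [map_measureReal_apply mT mB, map_measureReal_apply mT mB.compl, preimage_compl,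
      hpre i, h2] at h1
    linarith

end
end

section
/- Let f:(0,∞)→ℝ be convex with f(1)=0, fix s > 0, and let B(D) := inf{D_f(P‖Q) : D_{u_s}(P‖Q) ≥ D} over all pairs of probability measures on all measurable spaces. Then for every 0 ≤ D ≤ min(1,s), setting H := min(1,s) − D, B(D) = inf_{0 ≤ q ≤ H/s} [ (1−q) f((H − qs)/(1−q)) + q f((1 + qs − H)/q) ]. -/
open MeasureTheory Filter Set
open scoped ENNReal NNReal Classical

noncomputable section

theorem aux_subgrad (f : ℝ → ℝ) (hf : ConvexOn ℝ (Set.Ioi 0) f) (x : ℝ) (hx : 0 < x) :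
    ∃ m : ℝ, ∀ y, 0 < y → f x + m * (y - x) ≤ f y := by
  have hi : x ∈ interior (Set.Ioi (0:ℝ)) := by rw [interior_Ioi]; exact hx
  refine ⟨derivWithin f (Set.Ioi x) x, fun y hy => ?_⟩
  rcases lt_trichotomy x y with h | h | h
  · have := hf.rightDeriv_le_slope_of_mem_interior hi hy h
    rw [slope_def_field, le_div_iff₀ (by linarith)] at this
    linarith
  · subst h; simp
  · have h1 := hf.slope_le_leftDeriv_of_mem_interior hy hi h
    have h2 := hf.leftDeriv_le_rightDeriv_of_mem_interior hi
    have := h1.trans h2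
    rw [slope_def_field, div_le_iff₀ (by linarith)] at this
    linarith

theorem aux_limAtZero_ge (f : ℝ → ℝ) (a b : ℝ) (h : ∀ x, 0 < x → a * x + b ≤ f x) :
    (b : EReal) ≤ limAtZero f := by
  have ht : Tendsto (fun x : ℝ => ((a * x + b : ℝ) : EReal)) (nhdsWithin 0 (Set.Ioi 0))
      (nhds (b : EReal)) := by
    apply (continuous_coe_real_ereal.tendsto b).comp
    have : Continuous (fun x : ℝ => a * x + b) := by fun_prop
    have := (this.tendsto 0).mono_left (nhdsWithin_le_nhds (s := Set.Ioi (0:ℝ)))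
    simpa using this
  rw [← ht.limsup_eq]
  unfold limAtZero
  refine Filter.limsup_le_limsup ?_
  filter_upwards [self_mem_nhdsWithin] with x hx
  exact EReal.coe_le_coe_iff.2 (h x hx)

theorem aux_derivAtTop_ge (f : ℝ → ℝ) (a b : ℝ) (h : ∀ x, 0 < x → a * x + b ≤ f x) :
    (a : EReal) ≤ derivAtTop f := by
  have ht : Tendsto (fun x : ℝ => ((a + b / x : ℝ) : EReal)) atTop (nhds (a : EReal)) := by
    apply (continuous_coe_real_ereal.tendsto a).comp
    have := (tendsto_const_nhds (x := a) (f := atTop)).add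
      ((tendsto_const_nhds (x := b)).div_atTop (tendsto_id (α := ℝ)))
    simpa using this
  rw [← ht.limsup_eq]
  unfold derivAtTop
  refine Filter.limsup_le_limsup ?_
  filter_upwards [eventually_gt_atTop 0] with x hx
  refine EReal.coe_le_coe_iff.2 ?_
  rw [le_div_iff₀ hx, add_mul, div_mul_cancel₀ _ hx.ne']
  exact h x hx

theorem aux_P_decomp {Ω : Type*} [MeasurableSpace Ω] (P Q : Measure Ω)
    [IsProbabilityMeasure P] [IsProbabilityMeasure Q] (A : Set Ω) (hA : MeasurableSet A) :
    P.real A = (P.singularPart Q).real A + ∫ x in A, (P.rnDeriv Q x).toReal ∂Q := by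
  rw [Measure.setIntegral_toReal_rnDeriv_eq_withDensity' hA]
  conv_lhs => rw [← Measure.singularPart_add_rnDeriv P Q]
  rw [measureReal_add_apply]

theorem aux_lower {Ω : Type*} [MeasurableSpace Ω] (P Q : Measure Ω)
    [IsProbabilityMeasure P] [IsProbabilityMeasure Q] (f : ℝ → ℝ) (a0 b0 a1 b1 : ℝ)
    (h0 : ∀ x, 0 < x → a0 * x + b0 ≤ f x) (h1 : ∀ x, 0 < x → a1 * x + b1 ≤ f x)
    (h01 : a0 ≤ a1) (A : Set Ω) (hA : MeasurableSet A) :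
    ((a0 * P.real A + b0 * Q.real A + a1 * P.real Aᶜ + b1 * Q.real Aᶜ : ℝ) : EReal)
      ≤ fDiv f P Q := by
  set S := {x | P.rnDeriv Q x ≠ 0} with hS
  have hSm : MeasurableSet S :=
    (Measure.measurable_rnDeriv P Q) (measurableSet_singleton 0).compl
  have hSc : {x | P.rnDeriv Q x = 0} = Sᶜ := by ext x; simp [hS]
  have hrn : Integrable (fun x => (P.rnDeriv Q x).toReal) Q := Measure.integrable_toReal_rnDeriv
  set σ := P.singularPart Q
  set g : Ω → ℝ := fun x => A.piecewise (fun x => a0 * (P.rnDeriv Q x).toReal + b0)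
    (fun x => a1 * (P.rnDeriv Q x).toReal + b1) x with hg
  have hi0 : Integrable (fun x => a0 * (P.rnDeriv Q x).toReal + b0) Q :=
    (hrn.const_mul a0).add (integrable_const b0)
  have hi1 : Integrable (fun x => a1 * (P.rnDeriv Q x).toReal + b1) Q :=
    (hrn.const_mul a1).add (integrable_const b1)
  have hgi : Integrable g Q := Integrable.piecewise hA hi0.integrableOn hi1.integrableOn
  have hgint : ∫ x, g x ∂Q = a0 * ∫ x in A, (P.rnDeriv Q x).toReal ∂Q + b0 * Q.real A
      + a1 * ∫ x in Aᶜ, (P.rnDeriv Q x).toReal ∂Q + b1 * Q.real Aᶜ := by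
    rw [hg, integral_piecewise hA hi0.integrableOn hi1.integrableOn,
      integral_add (hrn.const_mul a0).integrableOn (integrable_const b0),
      integral_add (hrn.const_mul a1).integrableOn (integrable_const b1),
      integral_const_mul, integral_const_mul]
    simp
    ring
  have hsplit : ∫ x, g x ∂Q = ∫ x in S, g x ∂Q + ∫ x in Sᶜ, g x ∂Q :=
    (integral_add_compl hSm hgi).symm
  have hle2 : ∫ x in Sᶜ, g x ∂Q ≤ max b0 b1 * Q.real Sᶜ := by
    have : ∫ x in Sᶜ, g x ∂Q ≤ ∫ x in Sᶜ, max b0 b1 ∂Q := by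
      apply setIntegral_mono_on hgi.integrableOn (integrable_const _) hSm.compl
      intro x hx
      have : P.rnDeriv Q x = 0 := by rw [← hSc] at hx; exact hx
      by_cases hxA : x ∈ A <;> simp [hg, hxA, this]
    refine this.trans (le_of_eq ?_)
    simp [mul_comm]
  have hL0 : ((max b0 b1 : ℝ) : EReal) ≤ limAtZero f := by
    rcases max_choice b0 b1 with h | h <;> rw [h]
    · exact aux_limAtZero_ge f a0 b0 h0
    · exact aux_limAtZero_ge f a1 b1 h1
  have hLi : (a1 : EReal) ≤ derivAtTop f := aux_derivAtTop_ge f a1 b1 h1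
  have e1 : ((Q Sᶜ : ℝ≥0∞) : EReal) = ((Q.real Sᶜ : ℝ) : EReal) :=
    (EReal.coe_toReal (by simp) (by simp)).symm.trans (by simp [Measure.real])
  have e2 : ((σ univ : ℝ≥0∞) : EReal) = ((σ.real univ : ℝ) : EReal) :=
    (EReal.coe_toReal (by simp) (by simp)).symm.trans (by simp [Measure.real])
  have t0 : ((max b0 b1 * Q.real Sᶜ : ℝ) : EReal) ≤ limAtZero f * ((Q Sᶜ : ℝ≥0∞) : EReal) := by
    rw [e1, EReal.coe_mul]
    exact mul_le_mul_of_nonneg_right hL0 (by exact_mod_cast measureReal_nonneg)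
  have ti : ((a1 * σ.real univ : ℝ) : EReal) ≤ derivAtTop f * ((σ univ : ℝ≥0∞) : EReal) := by
    rw [e2, EReal.coe_mul]
    exact mul_le_mul_of_nonneg_right hLi (by exact_mod_cast measureReal_nonneg)
  have tf : ((∫ x in S, g x ∂Q : ℝ) : EReal) ≤
      (if Integrable (fun x => f ((Measure.rnDeriv P Q x).toReal)) (Q.restrict S)
       then ((∫ x in S, f ((Measure.rnDeriv P Q x).toReal) ∂Q : ℝ) : EReal)
       else (⊤ : EReal)) := by
    split_ifs with hI
    · refine EReal.coe_le_coe_iff.2 ?_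
      apply integral_mono_ae hgi.integrableOn hI
      have hlt : ∀ᵐ x ∂(Q.restrict S), P.rnDeriv Q x < ⊤ :=
        ae_restrict_of_ae (Measure.rnDeriv_lt_top P Q)
      filter_upwards [hlt, ae_restrict_mem hSm] with x hx hxS
      have hp : 0 < (P.rnDeriv Q x).toReal := ENNReal.toReal_pos hxS hx.ne
      by_cases hxA : x ∈ A
      · simpa [hg, hxA] using h0 _ hp
      · simpa [hg, hxA] using h1 _ hp
    · exact le_top
  have hfin := add_le_add (add_le_add tf t0) ti
  unfold fDiv
  rw [hSc]
  refine le_trans ?_ hfin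
  rw [← EReal.coe_add, ← EReal.coe_add]
  refine EReal.coe_le_coe_iff.2 ?_
  have pA := aux_P_decomp P Q A hA
  have pAc := aux_P_decomp P Q Aᶜ hA.compl
  have hsA : σ.real univ = σ.real A + σ.real Aᶜ := (measureReal_add_measureReal_compl hA).symm
  have hn : 0 ≤ σ.real A := measureReal_nonneg
  have : (a0 - a1) * σ.real A ≤ 0 := mul_nonpos_of_nonpos_of_nonneg (by linarith) hn
  rw [pA, pAc, hsA]
  nlinarith

/-- Extended perspective function. -/
def auxPhi (f : ℝ → ℝ) (p q : ℝ) : EReal :=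
  if q = 0 then derivAtTop f * (p : EReal) else if p = 0 then limAtZero f * (q : EReal)
  else ((q * f (p / q) : ℝ) : EReal)

theorem aux_M0 (f : ℝ → ℝ) (hf : ConvexOn ℝ (Set.Ioi 0) f) (hf1 : f 1 = 0) (m : ℝ)
    (hm : ∀ y, 0 < y → f 1 + m * (y - 1) ≤ f y) (p q : ℝ) (hp : 0 ≤ p) (hpq : p ≤ q)
    (c : ℝ) (hc : (c : EReal) < auxPhi f p q) :
    ∃ a b : ℝ, a ≤ m ∧ (∀ x, 0 < x → a * x + b ≤ f x) ∧ c ≤ a * p + b * q := by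
  have key : ∀ x, 0 < x → x ≤ 1 → ∃ a, a ≤ m ∧ ∀ y, 0 < y → f x + a * (y - x) ≤ f y := by
    intro x hx hx1
    rcases hx1.eq_or_lt with h | h
    · subst h; exact ⟨m, le_rfl, hm⟩
    · obtain ⟨a, ha⟩ := aux_subgrad f hf x hx
      refine ⟨a, ?_, ha⟩
      have h1 := ha 1 one_pos
      have h2 := hm x hx
      have : a * (1 - x) ≤ m * (1 - x) := by linarith
      exact le_of_mul_le_mul_right this (by linarith)
  unfold auxPhi at hc
  split_ifs at hc with hq hp0
  · have hp0 : p = 0 := by linarith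
    subst hp0; subst hq
    refine ⟨m, - m, le_rfl, fun x hx => by linarith [hm x hx], ?_⟩
    have : c < 0 := by simpa using hc
    linarith
  · subst hp0
    have hq' : 0 < q := lt_of_le_of_ne hpq (Ne.symm hq)
    have hc' : ((c / q : ℝ) : EReal) < limAtZero f := by
      by_contra hcon
      push Not at hcon
      have := mul_le_mul_of_nonneg_right hcon (show (0 : EReal) ≤ (q : EReal) by exact_mod_cast hpq)
      rw [← EReal.coe_mul, div_mul_cancel₀ _ hq] at this
      exact absurd hc (not_lt.2 this)
    obtain ⟨d, hd1, hd2⟩ := EReal.lt_iff_exists_real_btwn.1 hc'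
    have hd1 : c / q < d := EReal.coe_lt_coe_iff.1 hd1
    have hfr := Filter.frequently_lt_of_lt_limsup (by isBoundedDefault) hd2
    have hcont : Tendsto (fun x : ℝ => m * x) (nhdsWithin 0 (Set.Ioi 0)) (nhds 0) := by
      have : Continuous (fun x : ℝ => m * x) := by fun_prop
      simpa using (this.tendsto 0).mono_left (nhdsWithin_le_nhds (s := Set.Ioi (0:ℝ)))
    have ev1 := hcont.eventually (gt_mem_nhds (show (0:ℝ) < d - c / q by linarith))
    have ev2 : ∀ᶠ x : ℝ in nhdsWithin 0 (Set.Ioi 0), x ∈ Set.Ioc (0:ℝ) 1 :=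
      Ioc_mem_nhdsGT one_pos
    obtain ⟨x, hxd, hx1, hx2⟩ := (hfr.and_eventually (ev1.and ev2)).exists
    have hxd : d < f x := EReal.coe_lt_coe_iff.1 hxd
    obtain ⟨a, ham, ha⟩ := key x hx2.1 hx2.2
    refine ⟨a, f x - a * x, ham, fun y hy => by linarith [ha y hy], ?_⟩
    have h1 : a * x ≤ m * x := mul_le_mul_of_nonneg_right ham hx2.1.le
    have h2 : c / q ≤ f x - a * x := by linarith
    rw [div_le_iff₀ hq'] at h2
    linarith
  · have hp' : 0 < p := lt_of_le_of_ne hp (Ne.symm hp0)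
    have hq' : 0 < q := by linarith
    obtain ⟨a, ham, ha⟩ := key (p / q) (by positivity) ((div_le_one hq').2 hpq)
    refine ⟨a, f (p / q) - a * (p / q), ham, fun y hy => by linarith [ha y hy], ?_⟩
    have hc : c < q * f (p / q) := EReal.coe_lt_coe_iff.1 hc
    have : a * p + (f (p / q) - a * (p / q)) * q = q * f (p / q) := by field_simp; ring
    linarith

theorem aux_M1 (f : ℝ → ℝ) (hf : ConvexOn ℝ (Set.Ioi 0) f) (hf1 : f 1 = 0) (m : ℝ)
    (hm : ∀ y, 0 < y → f 1 + m * (y - 1) ≤ f y) (p q : ℝ) (hq0 : 0 ≤ q) (hpq : q ≤ p)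
    (c : ℝ) (hc : (c : EReal) < auxPhi f p q) :
    ∃ a b : ℝ, m ≤ a ∧ (∀ x, 0 < x → a * x + b ≤ f x) ∧ c ≤ a * p + b * q := by
  have key : ∀ x, 0 < x → 1 ≤ x → ∃ a, m ≤ a ∧ ∀ y, 0 < y → f x + a * (y - x) ≤ f y := by
    intro x hx hx1
    rcases hx1.eq_or_lt with h | h
    · subst h; exact ⟨m, le_rfl, hm⟩
    · obtain ⟨a, ha⟩ := aux_subgrad f hf x hx
      refine ⟨a, ?_, ha⟩
      have h1 := ha 1 one_pos
      have h2 := hm x hx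
      have : m * (x - 1) ≤ a * (x - 1) := by linarith
      exact le_of_mul_le_mul_right this (by linarith)
  unfold auxPhi at hc
  split_ifs at hc with hq hp0
  · subst hq
    rcases hpq.eq_or_lt with hp0 | hp0
    · subst hp0
      refine ⟨m, - m, le_rfl, fun x hx => by linarith [hm x hx], ?_⟩
      have : c < 0 := by simpa using hc
      linarith
    have hc' : ((c / p : ℝ) : EReal) < derivAtTop f := by
      by_contra hcon
      push Not at hcon
      have := mul_le_mul_of_nonneg_right hcon (show (0 : EReal) ≤ (p : EReal) by exact_mod_cast hpq)
      rw [← EReal.coe_mul, div_mul_cancel₀ _ hp0.ne'] at this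
      exact absurd hc (not_lt.2 this)
    obtain ⟨d, hd1, hd2⟩ := EReal.lt_iff_exists_real_btwn.1 hc'
    have hd1 : c / p < d := EReal.coe_lt_coe_iff.1 hd1
    have hfr := Filter.frequently_lt_of_lt_limsup (by isBoundedDefault) hd2
    have hcont : Tendsto (fun x : ℝ => (- m) / x) atTop (nhds 0) :=
      tendsto_const_nhds.div_atTop tendsto_id
    have ev1 := hcont.eventually (gt_mem_nhds (show (0:ℝ) < d - c / p by linarith))
    obtain ⟨x, hxd, hx1, hx2⟩ := (hfr.and_eventually (ev1.and (eventually_ge_atTop 1))).exists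
    have hxd : d < f x / x := EReal.coe_lt_coe_iff.1 hxd
    have hx0 : 0 < x := by linarith
    obtain ⟨a, ham, ha⟩ := key x hx0 hx2
    refine ⟨a, f x - a * x, ham, fun y hy => by linarith [ha y hy], ?_⟩
    have h1 := ha 1 one_pos
    have h2 : (f x + m) / x ≤ a := by
      rw [div_le_iff₀ hx0]; linarith
    have h3 : (f x + m) / x = f x / x - (-m) / x := by ring
    have h4 : c / p ≤ a := by linarith
    rw [div_le_iff₀ hp0] at h4
    linarith
  · exfalso; subst hp0; exact hq (le_antisymm hpq hq0)
  · have hq' : 0 < q := lt_of_le_of_ne hq0 (Ne.symm hq)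
    have hp' : 0 < p := by linarith
    obtain ⟨a, ham, ha⟩ := key (p / q) (by positivity) ((one_le_div hq').2 hpq)
    refine ⟨a, f (p / q) - a * (p / q), ham, fun y hy => by linarith [ha y hy], ?_⟩
    have hc : c < q * f (p / q) := EReal.coe_lt_coe_iff.1 hc
    have : a * p + (f (p / q) - a * (p / q)) * q = q * f (p / q) := by field_simp; ring
    linarith

theorem aux_two_lower {Ω : Type*} [MeasurableSpace Ω] (P Q : Measure Ω)
    [IsProbabilityMeasure P] [IsProbabilityMeasure Q] (f : ℝ → ℝ)
    (hf : ConvexOn ℝ (Set.Ioi 0) f) (hf1 : f 1 = 0) (A : Set Ω) (hA : MeasurableSet A)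
    (p : ℝ) (hp0 : 0 ≤ p) (hpA : P.real A ≤ p) (hpQ : p ≤ 1 - Q.real Aᶜ) :
    auxPhi f p (1 - Q.real Aᶜ) + auxPhi f (1 - p) (Q.real Aᶜ) ≤ fDiv f P Q := by
  obtain ⟨m, hm⟩ := aux_subgrad f hf 1 one_pos
  have hq : 0 ≤ Q.real Aᶜ := measureReal_nonneg
  have hPA : P.real A + P.real Aᶜ = 1 := by
    rw [measureReal_add_measureReal_compl hA]; simp
  have hQA : Q.real A + Q.real Aᶜ = 1 := by
    rw [measureReal_add_measureReal_compl hA]; simp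
  apply EReal.add_le_of_forall_lt
  intro c0 hc0 c1 hc1
  induction c0 with
  | bot => simp
  | top => exact absurd hc0 not_top_lt
  | coe c0 =>
    induction c1 with
    | bot => simp
    | top => exact absurd hc1 not_top_lt
    | coe c1 =>
      obtain ⟨a0, b0, h0m, h0, h0c⟩ := aux_M0 f hf hf1 m hm _ _ hp0 hpQ c0 hc0
      obtain ⟨a1, b1, h1m, h1, h1c⟩ := aux_M1 f hf hf1 m hm _ _ hq (by linarith) c1 hc1
      refine le_trans ?_ (aux_lower P Q f a0 b0 a1 b1 h0 h1 (h0m.trans h1m) A hA)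
      rw [← EReal.coe_add]
      refine EReal.coe_le_coe_iff.2 ?_
      have e1 : Q.real A = 1 - Q.real Aᶜ := by linarith
      have e2 : P.real Aᶜ = 1 - P.real A := by linarith
      rw [e1, e2]
      have : (a1 - a0) * (P.real A) ≤ (a1 - a0) * p :=
        mul_le_mul_of_nonneg_left hpA (by linarith)
      linarith

theorem aux_sing_atom (P Q : Measure (Fin 2)) [IsProbabilityMeasure P] [IsProbabilityMeasure Q]
    (i : Fin 2) (hq : Q.real {i} ≠ 0) : (P.singularPart Q).real {i} = 0 := by
  obtain ⟨N, hN, h1, h2⟩ := Measure.mutuallySingular_singularPart P Q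
  by_cases hi : i ∈ N
  · have : P.singularPart Q {i} = 0 := measure_mono_null (by simpa using hi) h1
    simp [Measure.real, this]
  · exfalso
    apply hq
    have : Q {i} = 0 := measure_mono_null (by simpa using hi) h2
    simp [Measure.real, this]

theorem aux_atom (f : ℝ → ℝ) (P Q : Measure (Fin 2)) [IsProbabilityMeasure P]
    [IsProbabilityMeasure Q] (i : Fin 2) :
    ((if P.rnDeriv Q i ≠ 0 then Q.real {i} * f (P.rnDeriv Q i).toReal else 0 : ℝ) : EReal)
      + limAtZero f * ((if P.rnDeriv Q i = 0 then Q.real {i} else 0 : ℝ) : EReal)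
      + derivAtTop f * (((P.singularPart Q).real {i} : ℝ) : EReal)
      = auxPhi f (P.real {i}) (Q.real {i}) := by
  have hd := aux_P_decomp P Q {i} (measurableSet_singleton i)
  rw [integral_singleton, smul_eq_mul] at hd
  unfold auxPhi
  by_cases hq : Q.real {i} = 0
  · rw [hq] at hd ⊢
    simp [hd]
  · have hs := aux_sing_atom P Q i hq
    rw [hs, zero_add] at hd
    rw [hs, if_neg hq, hd]
    have hlt : P.rnDeriv Q i ≠ ⊤ := by
      intro htop
      apply hq
      have h : Q {x | ¬ P.rnDeriv Q x < ⊤} = 0 := Measure.rnDeriv_lt_top P Q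
      have : Q {i} = 0 := measure_mono_null (by simp [htop]) h
      simp [Measure.real, this]
    by_cases hr : P.rnDeriv Q i = 0
    · simp [hr]
    · have : (P.rnDeriv Q i).toReal ≠ 0 := (ENNReal.toReal_pos hr hlt).ne'
      have e : Q.real {i} * (P.rnDeriv Q i).toReal / Q.real {i} = (P.rnDeriv Q i).toReal := by
        field_simp
      simp only [ne_eq, hr, not_false_eq_true, if_true, if_false]
      rw [if_neg (mul_ne_zero hq this), e]
      simp

theorem aux_fin2 (f : ℝ → ℝ) (P Q : Measure (Fin 2)) [IsProbabilityMeasure P]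
    [IsProbabilityMeasure Q] :
    fDiv f P Q = auxPhi f (P.real {0}) (Q.real {0}) + auxPhi f (P.real {1}) (Q.real {1}) := by
  rw [← aux_atom f P Q 0, ← aux_atom f P Q 1]
  have hreal : ∀ (μ : Measure (Fin 2)) [IsFiniteMeasure μ] (S : Set (Fin 2)),
      ((μ S : ℝ≥0∞) : EReal) = ((μ.real S : ℝ) : EReal) := fun μ _ S =>
    (EReal.coe_toReal (by simp) (by simp)).symm.trans (by simp [Measure.real])
  have hind : ∀ (μ : Measure (Fin 2)) [IsFiniteMeasure μ] (S : Set (Fin 2)),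
      μ.real S = (if (0 : Fin 2) ∈ S then μ.real {0} else 0)
        + (if (1 : Fin 2) ∈ S then μ.real {1} else 0) := by
    intro μ _ S
    have h1 : ∫ x, S.indicator (fun _ => (1:ℝ)) x ∂μ = μ.real S :=
      integral_indicator_one (MeasurableSet.of_discrete)
    rw [← h1, integral_fintype Integrable.of_finite]
    simp [Fin.sum_univ_two, Set.indicator_apply]
  have hint : ∫ x in {x | P.rnDeriv Q x ≠ 0}, f ((P.rnDeriv Q x).toReal) ∂Q
      = (if P.rnDeriv Q 0 ≠ 0 then Q.real {0} * f (P.rnDeriv Q 0).toReal else 0)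
       + (if P.rnDeriv Q 1 ≠ 0 then Q.real {1} * f (P.rnDeriv Q 1).toReal else 0) := by
    rw [← integral_indicator MeasurableSet.of_discrete, integral_fintype Integrable.of_finite]
    simp [Fin.sum_univ_two, Set.indicator_apply]
  unfold fDiv
  rw [if_pos Integrable.of_finite, hint, hreal, hreal, hind Q {x | P.rnDeriv Q x = 0},
    hind (P.singularPart Q) univ]
  simp only [Set.mem_ofPred_eq, mem_univ, if_true]
  rw [EReal.coe_add, EReal.coe_add, EReal.coe_add,
    EReal.left_distrib_of_nonneg (by split_ifs <;> simp) (by split_ifs <;> simp),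
    EReal.left_distrib_of_nonneg (by simp) (by simp)]
  split_ifs <;> abel

theorem aux_us_upper {Ω : Type*} [MeasurableSpace Ω] (P Q : Measure Ω)
    [IsProbabilityMeasure P] [IsProbabilityMeasure Q] (s : ℝ) (hs : 0 < s) :
    ∃ A : Set Ω, MeasurableSet A ∧ fDiv (fun t => min 1 s - min t s) P Q =
      ((min 1 s - (P.real A + s * Q.real Aᶜ) : ℝ) : EReal) := by
  obtain ⟨N, hN, hN1, hN2⟩ := Measure.mutuallySingular_singularPart P Q
  have hL0 : limAtZero (fun t => min 1 s - min t s) = ((min 1 s : ℝ) : EReal) := by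
    apply Tendsto.limsup_eq
    apply (continuous_coe_real_ereal.tendsto _).comp
    have : Continuous (fun t : ℝ => min 1 s - min t s) := by fun_prop
    have := (this.tendsto 0).mono_left (nhdsWithin_le_nhds (s := Set.Ioi (0:ℝ)))
    simpa [hs.le] using this
  have hLi : derivAtTop (fun t => min 1 s - min t s) = 0 := by
    apply Tendsto.limsup_eq
    rw [← EReal.coe_zero]
    apply (continuous_coe_real_ereal.tendsto _).comp
    have : Tendsto (fun x : ℝ => (min 1 s - s) / x) atTop (nhds 0) :=
      tendsto_const_nhds.div_atTop tendsto_id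
    refine this.congr' ?_
    filter_upwards [eventually_ge_atTop s] with x hx
    rw [min_eq_right hx]
  set S := {x | P.rnDeriv Q x ≠ 0} with hS
  have hmeas : Measurable (fun x => (P.rnDeriv Q x).toReal) :=
    (Measure.measurable_rnDeriv P Q).ennreal_toReal
  have hSm : MeasurableSet S :=
    (Measure.measurable_rnDeriv P Q) (measurableSet_singleton 0).compl
  have hSc : {x | P.rnDeriv Q x = 0} = Sᶜ := by ext x; simp [hS]
  have hrn : Integrable (fun x => (P.rnDeriv Q x).toReal) Q := Measure.integrable_toReal_rnDeriv
  have hmin : Integrable (fun x => min (P.rnDeriv Q x).toReal s) Q :=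
    hrn.inf (integrable_const s)
  have hu : Integrable (fun x => min 1 s - min (P.rnDeriv Q x).toReal s) Q :=
    (integrable_const _).sub hmin
  set A := {x | (P.rnDeriv Q x).toReal ≤ s} ∩ N with hAdef
  have hA : MeasurableSet A := (hmeas measurableSet_Iic).inter hN
  refine ⟨A, hA, ?_⟩
  have e1 : ((Q Sᶜ : ℝ≥0∞) : EReal) = ((Q.real Sᶜ : ℝ) : EReal) :=
    (EReal.coe_toReal (by simp) (by simp)).symm.trans (by simp [Measure.real])
  unfold fDiv
  rw [hL0, hLi, hSc, if_pos (show Integrable (fun x => (fun t => min 1 s - min t s) (P.rnDeriv Q x).toReal)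
    (Q.restrict {x | P.rnDeriv Q x ≠ 0}) from hu.integrableOn), e1, zero_mul, add_zero, ← EReal.coe_mul,
    ← EReal.coe_add]
  congr 1
  have hSc_int : ∫ x in Sᶜ, (min 1 s - min (P.rnDeriv Q x).toReal s) ∂Q
      = min 1 s * Q.real Sᶜ := by
    have : ∫ x in Sᶜ, (min 1 s - min (P.rnDeriv Q x).toReal s) ∂Q = ∫ x in Sᶜ, min 1 s ∂Q := by
      apply setIntegral_congr_fun hSm.compl
      intro x hx
      have : P.rnDeriv Q x = 0 := by rw [← hSc] at hx; exact hx
      simp [this, hs.le]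
    rw [this]; simp [mul_comm]
  rw [← hSc_int, integral_add_compl hSm hu, integral_sub (integrable_const _) hmin]
  simp only [integral_const, probReal_univ, one_smul]
  congr 1
  rw [← integral_add_compl hA hmin]
  congr 1
  · have h0 : (P.singularPart Q).real A = 0 := by
      have : P.singularPart Q A = 0 := measure_mono_null inter_subset_right hN1
      simp [Measure.real, this]
    rw [aux_P_decomp P Q A hA, h0, zero_add]
    apply setIntegral_congr_fun hA
    intro x hx
    exact min_eq_left hx.1
  · have : ∫ x in Aᶜ, min (P.rnDeriv Q x).toReal s ∂Q = ∫ x in Aᶜ, s ∂Q := by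
      apply setIntegral_congr_ae hA.compl
      have hae : ∀ᵐ x ∂Q, x ∈ N := by rw [ae_iff]; exact hN2
      filter_upwards [hae] with x hxN hx
      apply min_eq_right
      by_contra hcon
      exact hx ⟨(not_le.1 hcon).le, hxN⟩
    rw [this]; simp [mul_comm]

theorem aux_twoPoint (p : ℝ) (h0 : 0 ≤ p) (h1 : p ≤ 1) :
    ∃ P : Measure (Fin 2), IsProbabilityMeasure P ∧ P {0} = ENNReal.ofReal p ∧
      P {1} = ENNReal.ofReal (1 - p) := by
  refine ⟨ENNReal.ofReal p • Measure.dirac 0 + ENNReal.ofReal (1 - p) • Measure.dirac 1,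
    ⟨?_⟩, ?_, ?_⟩
  · simp [← ENNReal.ofReal_add h0 (sub_nonneg.2 h1)]
  · simp
  · simp

/-- **Lemma 7.** For a single primitive-divergence constraint `D_{u_s}(P‖Q) ≥ D` with
`0 ≤ D ≤ min(1,s)` and `H := min(1,s) - D`, the infimum `B(D)` of `D_f(P‖Q)` equals
`inf_{0 ≤ q ≤ H/s} [(1-q) f((H-qs)/(1-q)) + q f((1+qs-H)/q)]`, where the boundary values are
interpreted via the limits `f(0)` and `f'(∞)` (equivalently, the bracketed quantity is the
`f`-divergence of the pair of two-point probability measures `P = (H-qs, 1+qs-H)`,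
`Q = (1-q, q)`). -/
theorem inf_single_primitive_constraint (f : ℝ → ℝ)
    (hf : ConvexOn ℝ (Set.Ioi 0) f) (hf1 : f 1 = 0)
    (s : ℝ) (hs : 0 < s) (D : ℝ) (hD0 : 0 ≤ D) (hD1 : D ≤ min 1 s) :
    sInf {x : EReal | ∃ pp : PMPair,
        (D : EReal) ≤ fDiv (fun t => min 1 s - min t s) pp.P pp.Q ∧
        x = fDiv f pp.P pp.Q} =
    sInf {x : EReal | ∃ r : ℝ, 0 ≤ r ∧ r ≤ (min 1 s - D) / s ∧
      ∃ P Q : Measure (Fin 2), IsProbabilityMeasure P ∧ IsProbabilityMeasure Q ∧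
        P {0} = ENNReal.ofReal ((min 1 s - D) - r * s) ∧
        P {1} = ENNReal.ofReal (1 + r * s - (min 1 s - D)) ∧
        Q {0} = ENNReal.ofReal (1 - r) ∧ Q {1} = ENNReal.ofReal r ∧
        x = fDiv f P Q} := by
  set H := min 1 s - D with hH
  have hH0 : 0 ≤ H := by linarith
  have hH1 : H ≤ 1 := by linarith [min_le_left 1 s]
  have hHs : H ≤ s := by linarith [min_le_right 1 s]
  apply le_antisymm
  · skip
    apply sInf_le_sInf
    rintro x ⟨r, hr0, hr1, P, Q, hP, hQ, hP0, hP1, hQ0, hQ1, rfl⟩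
    refine ⟨⟨Fin 2, inferInstance, P, Q, hP, hQ⟩, ?_, rfl⟩
    have hrs : r * s ≤ H := (le_div_iff₀ hs).1 hr1
    have hrs0 : 0 ≤ r * s := mul_nonneg hr0 hs.le
    have hr1' : r ≤ 1 := hr1.trans ((div_le_one hs).2 hHs)
    have hc : ({0} : Set (Fin 2))ᶜ = {1} := by
      ext i; fin_cases i <;> simp
    have key := aux_lower P Q (fun t => min 1 s - min t s) (-1) (min 1 s) 0 (min 1 s - s)
      (fun x _ => by have := min_le_left x s; linarith)
      (fun x _ => by have := min_le_right x s; linarith) (by norm_num)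
      {0} (measurableSet_singleton 0)
    refine le_trans (EReal.coe_le_coe_iff.2 ?_) key
    rw [hc]
    simp only [Measure.real, hP0, hP1, hQ0, hQ1]
    rw [ENNReal.toReal_ofReal (by linarith), ENNReal.toReal_ofReal (by linarith),
      ENNReal.toReal_ofReal (by linarith), ENNReal.toReal_ofReal hr0]
    linarith
  · apply le_sInf
    rintro x ⟨pp, hpp, rfl⟩
    have := pp.probP
    have := pp.probQ
    obtain ⟨A, hA, hAeq⟩ := aux_us_upper pp.P pp.Q s hs
    rw [hAeq] at hpp
    have hpp := EReal.coe_le_coe_iff.1 hpp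
    set r := pp.Q.real Aᶜ with hr
    have hr0 : 0 ≤ r := measureReal_nonneg
    have hr1 : r ≤ 1 := measureReal_le_one
    have hPA : 0 ≤ pp.P.real A := measureReal_nonneg
    have hp0 : 0 ≤ H - r * s := by linarith
    have hpq : H - r * s ≤ 1 - r := by
      have h1 : min 1 s ≤ 1 := min_le_left 1 s
      have h2 : min 1 s ≤ s := min_le_right 1 s
      have h3 : (1 - r) * min 1 s ≤ (1 - r) * 1 := mul_le_mul_of_nonneg_left h1 (by linarith)
      have h4 : r * min 1 s ≤ r * s := mul_le_mul_of_nonneg_left h2 hr0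
      linarith
    have hlow := aux_two_lower pp.P pp.Q f hf hf1 A hA (H - r * s) hp0 (by linarith) hpq
    obtain ⟨P, hP, hP0, hP1⟩ := aux_twoPoint (H - r * s) hp0 (by linarith)
    obtain ⟨Q, hQ, hQ0, hQ1⟩ := aux_twoPoint (1 - r) (by linarith) (by linarith)
    rw [sub_sub_cancel] at hQ1
    refine le_trans (sInf_le ⟨r, hr0, (le_div_iff₀ hs).2 (by linarith), P, Q, hP, hQ, hP0, ?_,
      hQ0, hQ1, rfl⟩) (le_trans (le_of_eq ?_) hlow)
    · rw [hP1]; congr 1; ring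
    · rw [aux_fin2]
      simp only [Measure.real, hP0, hP1, hQ0, hQ1]
      rw [ENNReal.toReal_ofReal hp0, ENNReal.toReal_ofReal (by linarith),
        ENNReal.toReal_ofReal (by linarith), ENNReal.toReal_ofReal hr0]
      rfl

end
end

section
/- (Gilardoni) Let f:(0,∞)→ℝ be convex with f(1)=0 and let B(V) := inf{D_f(P‖Q) : V(P,Q) ≥ V} over all pairs of probability measures on all measurable spaces. Then for every 0 ≤ V ≤ 1, B(V) = inf{T(q,V) : 0 ≤ q ≤ 1−V}, where T(q,V) := (1−q) f((1−V−q)/(1−q)) + q f((q+V)/q). Consequently, for every pair of probability measures P and Q, D_f(P‖Q) ≥ inf{T(q, V(P,Q)) : 0 ≤ q ≤ 1 − V(P,Q)}, and this is the sharpest possible inequality between D_f and the total variation distance. -/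
open MeasureTheory Filter Set
open scoped ENNReal NNReal Classical

noncomputable section

def Minor (f : ℝ → ℝ) (α β : ℝ) : Prop := ∀ x : ℝ, 0 < x → α + β * x ≤ f x

lemma exists_support {f : ℝ → ℝ} (hf : ConvexOn ℝ (Set.Ioi 0) f) {x₀ : ℝ} (hx₀ : 0 < x₀) :
    ∃ α β : ℝ, Minor f α β ∧ α + β * x₀ = f x₀ := by
  set β := derivWithin f (Set.Ioi x₀) x₀ with hβ
  have hint : x₀ ∈ interior (Set.Ioi (0 : ℝ)) := by rw [interior_Ioi]; exact hx₀
  refine ⟨f x₀ - β * x₀, β, ?_, by ring⟩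
  intro x hx
  rcases lt_trichotomy x x₀ with h | h | h
  · have h1 := hf.slope_le_leftDeriv_of_mem_interior (x := x) (y := x₀) hx hint h
    have h2 := hf.leftDeriv_le_rightDeriv_of_mem_interior hint
    have h3 := h1.trans h2
    rw [slope_def_field, div_le_iff₀ (by linarith)] at h3
    change _ ≤ β * _ at h3
    linarith
  · subst h; linarith
  · have h1 := hf.rightDeriv_le_slope_of_mem_interior (x := x₀) (y := x) hint hx h
    rw [slope_def_field, le_div_iff₀ (by linarith)] at h1
    change β * _ ≤ _ at h1
    linarith

lemma limAtZero_minor {f : ℝ → ℝ} (hf : ConvexOn ℝ (Set.Ioi 0) f) {c : ℝ}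
    (hc : (c : EReal) < limAtZero f) : ∃ β, Minor f c β := by
  have hfr := frequently_lt_of_lt_limsup (by isBoundedDefault) hc
  obtain ⟨α₀, β₀, hm, -⟩ := exists_support hf one_pos
  have hex : ∃ δ : ℝ, 0 < δ ∧ ∀ x, 0 < x → x < δ → c ≤ f x := by
    by_contra! hcon
    obtain ⟨y, hy0, -, hyc⟩ := hcon 1 one_pos
    apply hfr
    filter_upwards [Ioo_mem_nhdsGT hy0] with x hx
    obtain ⟨z, hz0, hzx, hzc⟩ := hcon x hx.1
    have hconv := hf.convex_le c
    have := hconv.ordConnected.out (x := z) (y := y) ⟨hz0, hzc.le⟩ ⟨hy0, hyc.le⟩ ⟨hzx.le, hx.2.le⟩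
    simpa using this.2
  obtain ⟨δ, hδ, hx⟩ := hex
  refine ⟨min 0 (β₀ - |c - α₀| / δ), fun x hx0 => ?_⟩
  rcases lt_or_ge x δ with h | h
  · have := hx x hx0 h
    nlinarith [min_le_left 0 (β₀ - |c - α₀| / δ)]
  · have h1 := hm x hx0
    have h2 : min 0 (β₀ - |c - α₀| / δ) * x ≤ (β₀ - |c - α₀| / δ) * x :=
      mul_le_mul_of_nonneg_right (min_le_right _ _) hx0.le
    have h3 : |c - α₀| / δ * δ ≤ |c - α₀| / δ * x :=
      mul_le_mul_of_nonneg_left h (by positivity)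
    rw [div_mul_cancel₀ _ hδ.ne'] at h3
    nlinarith [le_abs_self (c - α₀)]

lemma derivAtTop_minor {f : ℝ → ℝ} (hf : ConvexOn ℝ (Set.Ioi 0) f) {c : ℝ}
    (hc : (c : EReal) < derivAtTop f) : ∃ α, Minor f α c := by
  have hfr := frequently_lt_of_lt_limsup (by isBoundedDefault) hc
  obtain ⟨α₀, β₀, hm, -⟩ := exists_support hf one_pos
  have hg : ConvexOn ℝ (Set.Ioi 0) (fun x => f x + (-c) * x) := by
    refine hf.add ?_
    refine ⟨convex_Ioi 0, fun x _ y _ a b _ _ _ => ?_⟩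
    simp only [smul_eq_mul]
    apply le_of_eq; ring
  have hex : ∃ N : ℝ, 0 < N ∧ ∀ x, N < x → c * x ≤ f x := by
    by_contra! hcon
    obtain ⟨y, hy0, hyc⟩ := hcon 1 one_pos
    apply hfr
    filter_upwards [Ioi_mem_atTop y] with x hx
    have hx : y < x := hx
    have hx0 : 0 < x := by linarith
    obtain ⟨z, hzx, hzc⟩ := hcon x hx0
    have hconv := hg.convex_le 0
    have := hconv.ordConnected.out (x := y) (y := z) ⟨by simp; linarith, by linarith⟩
      ⟨by simp; linarith, by linarith⟩ ⟨hx.le, hzx.le⟩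
    have h2 := this.2
    rw [not_lt, EReal.coe_le_coe_iff, div_le_iff₀ hx0]
    linarith
  obtain ⟨N, hN, hx⟩ := hex
  refine ⟨min 0 (α₀ - |c - β₀| * N), fun x hx0 => ?_⟩
  rcases lt_or_ge N x with h | h
  · have := hx x h
    linarith [min_le_left 0 (α₀ - |c - β₀| * N)]
  · have h1 := hm x hx0
    have h2 := min_le_right 0 (α₀ - |c - β₀| * N)
    have h3 : |c - β₀| * x ≤ |c - β₀| * N := mul_le_mul_of_nonneg_left h (abs_nonneg _)
    have h4 : (c - β₀) * x ≤ |c - β₀| * x := mul_le_mul_of_nonneg_right (le_abs_self _) hx0.le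
    linarith

lemma Minor.le_limAtZero {f : ℝ → ℝ} {α β : ℝ} (h : Minor f α β) : (α : EReal) ≤ limAtZero f := by
  have ht : Tendsto (fun x : ℝ => ((α + β * x : ℝ) : EReal)) (nhdsWithin 0 (Set.Ioi 0))
      (nhds (α : EReal)) := by
    refine (continuous_coe_real_ereal.tendsto α).comp ?_
    have : Tendsto (fun x : ℝ => α + β * x) (nhds 0) (nhds (α + β * 0)) :=
      Continuous.tendsto (by fun_prop) 0
    simp only [mul_zero, add_zero] at this
    exact this.mono_left nhdsWithin_le_nhds
  rw [← ht.limsup_eq]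
  refine limsup_le_limsup ?_ (by isBoundedDefault) (by isBoundedDefault)
  filter_upwards [self_mem_nhdsWithin] with x hx
  exact EReal.coe_le_coe_iff.2 (h x hx)

lemma Minor.le_derivAtTop {f : ℝ → ℝ} {α β : ℝ} (h : Minor f α β) :
    (β : EReal) ≤ derivAtTop f := by
  have ht : Tendsto (fun x : ℝ => ((α * x⁻¹ + β : ℝ) : EReal)) atTop
      (nhds (β : EReal)) := by
    refine (continuous_coe_real_ereal.tendsto β).comp ?_
    have := (tendsto_inv_atTop_zero (𝕜 := ℝ)).const_mul α |>.add_const β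
    simpa using this
  rw [← ht.limsup_eq]
  refine limsup_le_limsup ?_ (by isBoundedDefault) (by isBoundedDefault)
  filter_upwards [Ioi_mem_atTop 0] with x hx
  have hx : 0 < x := hx
  refine EReal.coe_le_coe_iff.2 ?_
  rw [le_div_iff₀ hx]
  have := h x hx
  field_simp
  linarith

lemma lt_mul_aux {L c : EReal} {q : ℝ} (hq : 0 < q) (h : c < L * (q : EReal)) :
    ∃ d : ℝ, (d : EReal) < L ∧ c ≤ ((d * q : ℝ) : EReal) := by
  obtain ⟨e, hce, heL⟩ := EReal.lt_iff_exists_real_btwn.1 h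
  refine ⟨e / q, ?_, ?_⟩
  · by_contra! hcon
    have : L * (q : EReal) ≤ ((e / q : ℝ) : EReal) * (q : EReal) :=
      mul_le_mul_of_nonneg_right hcon (by exact_mod_cast hq.le)
    rw [← EReal.coe_mul, div_mul_cancel₀ _ hq.ne'] at this
    exact absurd heL (not_lt.2 this)
  · rw [div_mul_cancel₀ _ hq.ne']; exact hce.le

lemma coe_toReal_aux {q : ℝ≥0∞} (hq : q ≠ ∞) : (q : EReal) = ((q.toReal : ℝ) : EReal) :=
  (EReal.coe_ennreal_toReal hq).symm

lemma tv_split {Ω : Type*} [MeasurableSpace Ω] (P Q : Measure Ω) [IsProbabilityMeasure P]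
    [IsProbabilityMeasure Q] {A : Set Ω} (hA : MeasurableSet A) :
    (∫ x in A, ((P.rnDeriv (P + Q) x).toReal - (Q.rnDeriv (P + Q) x).toReal) ∂(P + Q)) =
      P.real A - Q.real A := by
  have hP : P ≪ P + Q := Measure.AbsolutelyContinuous.rfl.add_right Q
  have hQ : Q ≪ P + Q := by
    rw [add_comm]; exact Measure.AbsolutelyContinuous.rfl.add_right P
  rw [integral_sub Measure.integrable_toReal_rnDeriv.integrableOn
    Measure.integrable_toReal_rnDeriv.integrableOn, Measure.setIntegral_toReal_rnDeriv hP,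
    Measure.setIntegral_toReal_rnDeriv hQ]

lemma tv_abs_split {Ω : Type*} [MeasurableSpace Ω] (P Q : Measure Ω) [IsProbabilityMeasure P]
    [IsProbabilityMeasure Q] {A : Set Ω} (hA : MeasurableSet A) :
    tvDist P Q = ((∫ x in A, |(P.rnDeriv (P + Q) x).toReal - (Q.rnDeriv (P + Q) x).toReal|
      ∂(P + Q)) + ∫ x in Aᶜ, |(P.rnDeriv (P + Q) x).toReal - (Q.rnDeriv (P + Q) x).toReal|
      ∂(P + Q)) / 2 := by
  unfold tvDist
  rw [integral_add_compl hA]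
  exact (Measure.integrable_toReal_rnDeriv.sub Measure.integrable_toReal_rnDeriv).abs

lemma tv_exists {Ω : Type*} [MeasurableSpace Ω] (P Q : Measure Ω) [IsProbabilityMeasure P]
    [IsProbabilityMeasure Q] :
    ∃ A : Set Ω, MeasurableSet A ∧ tvDist P Q = P.real A - Q.real A := by
  have hA : MeasurableSet {x | (Q.rnDeriv (P + Q) x).toReal ≤ (P.rnDeriv (P + Q) x).toReal} :=
    measurableSet_le (Measure.measurable_rnDeriv _ _).ennreal_toReal
      (Measure.measurable_rnDeriv _ _).ennreal_toReal
  refine ⟨_, hA, ?_⟩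
  rw [tv_abs_split P Q hA]
  have h1 := tv_split P Q hA
  have h2 := tv_split P Q hA.compl
  rw [setIntegral_congr_fun (g := fun x => (P.rnDeriv (P + Q) x).toReal -
    (Q.rnDeriv (P + Q) x).toReal) hA, h1]
  · rw [setIntegral_congr_fun (g := fun x => -((P.rnDeriv (P + Q) x).toReal -
      (Q.rnDeriv (P + Q) x).toReal)) hA.compl, integral_neg, h2,
      probReal_compl_eq_one_sub hA, probReal_compl_eq_one_sub hA]
    · ring
    · intro x hx
      have hx : ¬ ((Q.rnDeriv (P + Q) x).toReal ≤ (P.rnDeriv (P + Q) x).toReal) := hx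
      exact abs_of_nonpos (by linarith)
  · intro x hx
    have hx : ((Q.rnDeriv (P + Q) x).toReal ≤ (P.rnDeriv (P + Q) x).toReal) := hx
    exact abs_of_nonneg (by linarith)

lemma coe_le_mul_aux {L : EReal} {a a' : ℝ} {m n : ℝ} (ha : (a : EReal) ≤ L)
    (ha' : (a' : EReal) ≤ L) (hm : 0 ≤ m) (hn : 0 ≤ n) :
    ((a * m + a' * n : ℝ) : EReal) ≤ L * ((m + n : ℝ) : EReal) := by
  have h : (max a a' : ℝ) * (m + n) ≥ a * m + a' * n := by
    nlinarith [le_max_left a a', le_max_right a a']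
  have h2 : ((max a a' : ℝ) : EReal) ≤ L := by
    rcases max_choice a a' with h | h <;> rw [h] <;> assumption
  calc ((a * m + a' * n : ℝ) : EReal) ≤ (((max a a' : ℝ) * (m + n) : ℝ) : EReal) :=
        EReal.coe_le_coe_iff.2 h
    _ = ((max a a' : ℝ) : EReal) * ((m + n : ℝ) : EReal) := EReal.coe_mul _ _
    _ ≤ _ := mul_le_mul_of_nonneg_right h2 (by exact_mod_cast add_nonneg hm hn)

lemma integral_minor {Ω : Type*} [MeasurableSpace Ω] (P Q : Measure Ω) [IsProbabilityMeasure P]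
    [IsProbabilityMeasure Q] {f : ℝ → ℝ} {α β : ℝ} (h : Minor f α β) {B : Set Ω}
    (hB : MeasurableSet B) (hB0 : ∀ x ∈ B, P.rnDeriv Q x ≠ 0)
    (hi : IntegrableOn (fun x => f ((P.rnDeriv Q x).toReal)) B Q) :
    α * Q.real B + β * (∫ x in B, (P.rnDeriv Q x).toReal ∂Q) ≤
      ∫ x in B, f ((P.rnDeriv Q x).toReal) ∂Q := by
  have hg : IntegrableOn (fun x => (P.rnDeriv Q x).toReal) B Q :=
    Measure.integrable_toReal_rnDeriv.integrableOn
  have : α * Q.real B + β * (∫ x in B, (P.rnDeriv Q x).toReal ∂Q) =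
      ∫ x in B, (α + β * (P.rnDeriv Q x).toReal) ∂Q := by
    rw [integral_add (integrable_const α) (hg.const_mul β), integral_const_mul]
    simp [mul_comm]
  rw [this]
  refine integral_mono_ae ((integrable_const α).add (hg.const_mul β)) hi ?_
  filter_upwards [ae_restrict_mem hB, ae_restrict_of_ae (Measure.rnDeriv_lt_top P Q)] with x hx hx2
  exact h _ (ENNReal.toReal_pos (hB0 x hx) hx2.ne)

lemma fDiv_ge {Ω : Type*} [MeasurableSpace Ω] (P Q : Measure Ω) [IsProbabilityMeasure P]
    [IsProbabilityMeasure Q] {f : ℝ → ℝ} {α β α' β' : ℝ} (h : Minor f α β) (h' : Minor f α' β')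
    {A : Set Ω} (hA : MeasurableSet A) :
    ((α * Q.real A + β * P.real A + (α' * Q.real Aᶜ + β' * P.real Aᶜ) : ℝ) : EReal)
      ≤ fDiv f P Q := by
  have hgm : Measurable (P.rnDeriv Q) := Measure.measurable_rnDeriv P Q
  set N := {x | P.rnDeriv Q x ≠ 0} with hN
  have hNm : MeasurableSet N := hgm (measurableSet_singleton 0).compl
  have hNc : {x | P.rnDeriv Q x = 0} = Nᶜ := by ext x; simp [hN]
  have hsplitN : ∀ B : Set Ω, MeasurableSet B → Q.real B = Q.real (N ∩ B) + Q.real (Nᶜ ∩ B) := by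
    intro B hB
    rw [Set.inter_comm N, Set.inter_comm Nᶜ, ← Set.sdiff_eq, measureReal_inter_add_sdiff hNm]
  have hsplitA : ∀ (R : Measure Ω) [IsFiniteMeasure R] (B : Set Ω),
      R.real B = R.real (B ∩ A) + R.real (B ∩ Aᶜ) := by
    intro R _ B
    rw [← Set.sdiff_eq, measureReal_inter_add_sdiff hA]
  have hP : ∀ B : Set Ω, MeasurableSet B → P.real B =
      (∫ x in N ∩ B, (P.rnDeriv Q x).toReal ∂Q) + (P.singularPart Q).real B := by
    intro B hB
    have h1 : P.real B = (Q.withDensity (P.rnDeriv Q)).real B + (P.singularPart Q).real B := by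
      conv_lhs => rw [← Measure.rnDeriv_add_singularPart P Q]
      rw [measureReal_add_apply]
    rw [h1, ← Measure.setIntegral_toReal_rnDeriv_eq_withDensity]
    congr 1
    apply setIntegral_eq_of_subset_of_forall_sdiff_eq_zero hB Set.inter_subset_right
    intro x hx
    have : P.rnDeriv Q x = 0 := by
      by_contra hne
      exact hx.2 ⟨hne, hx.1⟩
    simp [this]
  have e1 : ((α * Q.real (N ∩ A) + β * (∫ x in N ∩ A, (P.rnDeriv Q x).toReal ∂Q) +
      (α' * Q.real (N ∩ Aᶜ) + β' * (∫ x in N ∩ Aᶜ, (P.rnDeriv Q x).toReal ∂Q)) : ℝ) : EReal) ≤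
      (if Integrable (fun x => f ((Measure.rnDeriv P Q x).toReal)) (Q.restrict N)
       then ((∫ x in N, f ((Measure.rnDeriv P Q x).toReal) ∂Q : ℝ) : EReal)
       else (⊤ : EReal)) := by
    split_ifs with hi
    · refine EReal.coe_le_coe_iff.2 ?_
      have hi : IntegrableOn (fun x => f ((P.rnDeriv Q x).toReal)) N Q := hi
      rw [← integral_inter_add_sdiff hA hi, Set.sdiff_eq]
      refine add_le_add (integral_minor P Q h (hNm.inter hA) (fun x hx => hx.1)
        (hi.mono_set Set.inter_subset_left)) (integral_minor P Q h' (hNm.inter hA.compl)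
          (fun x hx => hx.1) (hi.mono_set Set.inter_subset_left))
    · exact le_top
  have e2 : ((α * Q.real (Nᶜ ∩ A) + α' * Q.real (Nᶜ ∩ Aᶜ) : ℝ) : EReal) ≤
      limAtZero f * ((Q Nᶜ : ℝ≥0∞) : EReal) := by
    rw [coe_toReal_aux (measure_ne_top Q _), ← measureReal_def, hsplitA Q Nᶜ]
    exact coe_le_mul_aux h.le_limAtZero h'.le_limAtZero measureReal_nonneg measureReal_nonneg
  have e3 : ((β * (P.singularPart Q).real A + β' * (P.singularPart Q).real Aᶜ : ℝ) : EReal) ≤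
      derivAtTop f * ((P.singularPart Q Set.univ : ℝ≥0∞) : EReal) := by
    rw [coe_toReal_aux (measure_ne_top _ _), ← measureReal_def,
      hsplitA (P.singularPart Q) Set.univ, Set.univ_inter, Set.univ_inter]
    exact coe_le_mul_aux h.le_derivAtTop h'.le_derivAtTop measureReal_nonneg measureReal_nonneg
  have := add_le_add (add_le_add e1 e2) e3
  unfold fDiv
  rw [hNc]
  refine le_trans (le_of_eq ?_) this
  rw [← EReal.coe_add, ← EReal.coe_add, hP A hA, hP Aᶜ hA.compl, hsplitN A hA,
    hsplitN Aᶜ hA.compl]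
  congr 1
  ring

/-- Contribution of a single point to the divergence. -/
def ptTerm (f : ℝ → ℝ) (P Q : Measure (Fin 2)) (x : Fin 2) : EReal :=
  ((if P.rnDeriv Q x ≠ 0 then Q.real {x} * f ((P.rnDeriv Q x).toReal) else 0 : ℝ) : EReal)
  + limAtZero f * (((if P.rnDeriv Q x = 0 then Q {x} else 0) : ℝ≥0∞) : EReal)
  + derivAtTop f * ((P.singularPart Q {x} : ℝ≥0∞) : EReal)

lemma measure_fin2 (R : Measure (Fin 2)) (s : Set (Fin 2)) :
    R s = (if 0 ∈ s then R {0} else 0) + (if 1 ∈ s then R {1} else 0) := by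
  have : R s = lintegral R (s.indicator 1) := by
    rw [lintegral_indicator_one (Set.toFinite s).measurableSet]
  rw [this, lintegral_fintype]
  simp [Fin.sum_univ_two, Set.indicator_apply]

lemma fDiv_fin2 (f : ℝ → ℝ) (P Q : Measure (Fin 2)) [IsProbabilityMeasure P]
    [IsProbabilityMeasure Q] : fDiv f P Q = ptTerm f P Q 0 + ptTerm f P Q 1 := by
  unfold fDiv
  rw [if_pos Integrable.of_finite, ← integral_indicator (Set.toFinite _).measurableSet,
    integral_fintype Integrable.of_finite, measure_fin2 Q {x | P.rnDeriv Q x = 0},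
    measure_fin2 (P.singularPart Q) Set.univ]
  simp only [Fin.sum_univ_two, Set.indicator_apply, Set.mem_ofPred_eq, Set.mem_univ, if_true,
    EReal.coe_ennreal_add, EReal.coe_add, smul_eq_mul, mul_ite, mul_zero]
  rw [EReal.left_distrib_of_nonneg (EReal.coe_ennreal_nonneg _) (EReal.coe_ennreal_nonneg _),
    EReal.left_distrib_of_nonneg (EReal.coe_ennreal_nonneg _) (EReal.coe_ennreal_nonneg _)]
  unfold ptTerm
  have hab : ∀ a b c d e g : EReal, a + b + (c + d) + (e + g) = (a + c + e) + (b + d + g) := by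
    intros; abel
  rw [hab]
  congr!

lemma ptTerm_minor {f : ℝ → ℝ} (hf : ConvexOn ℝ (Set.Ioi 0) f) (P Q : Measure (Fin 2))
    [IsProbabilityMeasure P] [IsProbabilityMeasure Q] (x : Fin 2) {c : EReal}
    (hc : c < ptTerm f P Q x) :
    ∃ α β, Minor f α β ∧ c ≤ ((α * Q.real {x} + β * P.real {x} : ℝ) : EReal) := by
  have hdec : P {x} = P.rnDeriv Q x * Q {x} + P.singularPart Q {x} := by
    conv_lhs => rw [← Measure.rnDeriv_add_singularPart P Q]
    rw [Measure.add_apply, withDensity_apply _ (measurableSet_singleton x), lintegral_singleton]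
  obtain ⟨α₀, β₀, hm, -⟩ := exists_support hf one_pos
  unfold ptTerm at hc
  by_cases hQ : Q {x} = 0
  · have hQr : Q.real {x} = 0 := by simp [measureReal_def, hQ]
    have hs : P.singularPart Q {x} = P {x} := by rw [hdec, hQ]; simp
    have hc2 : c < derivAtTop f * ((P.real {x} : ℝ) : EReal) := by
      rw [hs, hQ, hQr] at hc
      rw [measureReal_def, ← coe_toReal_aux (measure_ne_top P _)]
      simpa using hc
    rcases (measureReal_nonneg (μ := P) (s := {x})).eq_or_lt with h0 | h0
    · refine ⟨α₀, β₀, hm, ?_⟩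
      rw [← h0] at hc2 ⊢
      rw [hQr]
      simp at hc2 ⊢
      exact hc2.le
    · obtain ⟨d, hd, hcd⟩ := lt_mul_aux h0 hc2
      obtain ⟨α, hα⟩ := derivAtTop_minor hf hd
      refine ⟨α, d, hα, ?_⟩
      rw [hQr, mul_zero, zero_add]
      exact hcd
  · have hQr : 0 < Q.real {x} := ENNReal.toReal_pos hQ (measure_ne_top _ _)
    have hs : P.singularPart Q {x} = 0 := by
      obtain ⟨s, hsm, hs1, hs2⟩ := Measure.mutuallySingular_singularPart P Q
      have hxs : x ∈ s := by
        by_contra hx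
        exact hQ (measure_mono_null (by simpa using hx) hs2)
      exact measure_mono_null (by simpa using hxs) hs1
    rw [hs, add_zero] at hdec
    by_cases hg : P.rnDeriv Q x = 0
    · have hP : P.real {x} = 0 := by simp [measureReal_def, hdec, hg]
      have hc2 : c < limAtZero f * ((Q.real {x} : ℝ) : EReal) := by
        rw [measureReal_def, ← coe_toReal_aux (measure_ne_top Q _)]
        simpa [hs, hg] using hc
      obtain ⟨d, hd, hcd⟩ := lt_mul_aux hQr hc2
      obtain ⟨β, hβ⟩ := limAtZero_minor hf hd
      refine ⟨d, β, hβ, ?_⟩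
      rw [hP, mul_zero, add_zero]
      exact hcd
    · have hPr : P.real {x} = (P.rnDeriv Q x).toReal * Q.real {x} := by
        simp [measureReal_def, hdec]
      have hgt : P.rnDeriv Q x ≠ ∞ := by
        intro h
        rw [h, ENNReal.top_mul hQ] at hdec
        exact measure_ne_top P _ hdec
      obtain ⟨α, β, h1, h2⟩ := exists_support hf (ENNReal.toReal_pos hg hgt)
      refine ⟨α, β, h1, ?_⟩
      have : α * Q.real {x} + β * P.real {x} = Q.real {x} * f ((P.rnDeriv Q x).toReal) := by
        rw [← h2, hPr]; ring
      rw [this]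
      simp only [hs, ne_eq, hg, not_false_eq_true, if_true, if_false, EReal.coe_ennreal_zero,
        mul_zero, add_zero] at hc
      exact hc.le

lemma fDiv_fin2_le {f : ℝ → ℝ} (hf : ConvexOn ℝ (Set.Ioi 0) f) (P Q : Measure (Fin 2))
    [IsProbabilityMeasure P] [IsProbabilityMeasure Q] {D : EReal}
    (h : ∀ α β α' β', Minor f α β → Minor f α' β' →
      ((α * Q.real {1} + β * P.real {1} + (α' * Q.real {0} + β' * P.real {0}) : ℝ) : EReal) ≤ D) :
    fDiv f P Q ≤ D := by
  rw [fDiv_fin2, add_comm]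
  refine EReal.add_le_of_forall_lt fun a ha b hb => ?_
  obtain ⟨α, β, h1, h2⟩ := ptTerm_minor hf P Q 1 ha
  obtain ⟨α', β', h1', h2'⟩ := ptTerm_minor hf P Q 0 hb
  refine le_trans (add_le_add h2 h2') ?_
  rw [← EReal.coe_add]
  exact h _ _ _ _ h1 h1'

lemma two_point_exists {f : ℝ → ℝ} (hf : ConvexOn ℝ (Set.Ioi 0) f) (hf1 : f 1 = 0)
    {Ω : Type*} [MeasurableSpace Ω] (P Q : Measure Ω) [IsProbabilityMeasure P]
    [IsProbabilityMeasure Q] {V : ℝ} (hV : 0 ≤ V) (hVt : V ≤ tvDist P Q) :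
    ∃ r : ℝ, 0 ≤ r ∧ r ≤ 1 - V ∧
        ∃ P' Q' : Measure (Fin 2), IsProbabilityMeasure P' ∧ IsProbabilityMeasure Q' ∧
          P' {0} = ENNReal.ofReal (1 - V - r) ∧ P' {1} = ENNReal.ofReal (r + V) ∧
          Q' {0} = ENNReal.ofReal (1 - r) ∧ Q' {1} = ENNReal.ofReal r ∧
          fDiv f P' Q' ≤ fDiv f P Q := by
  obtain ⟨A, hA, hAt⟩ := tv_exists P Q
  have hP1 : P.real A ≤ 1 := measureReal_le_one
  have hQ0 : 0 ≤ Q.real A := measureReal_nonneg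
  have hr1 : Q.real A ≤ 1 - V := by linarith
  obtain ⟨t, ht0, ht1, htV⟩ : ∃ t : ℝ, 0 ≤ t ∧ t ≤ 1 ∧ V = t * (P.real A - Q.real A) := by
    rw [hAt] at hVt
    rcases (hV.trans hVt).eq_or_lt with h | h
    · exact ⟨0, le_rfl, zero_le_one, by linarith⟩
    · exact ⟨V / (P.real A - Q.real A), by positivity, (div_le_one h).2 hVt, by field_simp⟩
  have hprob : ∀ a b : ℝ, 0 ≤ a → 0 ≤ b → a + b = 1 → IsProbabilityMeasure
      (ENNReal.ofReal a • Measure.dirac (0 : Fin 2) + ENNReal.ofReal b • Measure.dirac 1) := by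
    intro a b ha hb hab
    constructor
    simp [← ENNReal.ofReal_add ha hb, hab]
  have hv0 : ∀ a b : ℝ, (ENNReal.ofReal a • Measure.dirac (0 : Fin 2) +
      ENNReal.ofReal b • Measure.dirac 1 : Measure (Fin 2)) {0} = ENNReal.ofReal a := by
    intro a b; simp
  have hv1 : ∀ a b : ℝ, (ENNReal.ofReal a • Measure.dirac (0 : Fin 2) +
      ENNReal.ofReal b • Measure.dirac 1 : Measure (Fin 2)) {1} = ENNReal.ofReal b := by
    intro a b; simp
  have i1 := hprob (1 - V - Q.real A) (Q.real A + V) (by linarith) (by linarith) (by ring)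
  have i2 := hprob (1 - Q.real A) (Q.real A) (by linarith) (by linarith) (by ring)
  refine ⟨Q.real A, hQ0, hr1, _, _, i1, i2, hv0 _ _, hv1 _ _, hv0 _ _, hv1 _ _, ?_⟩
  apply fDiv_fin2_le hf
  intro α β α' β' h h'
  obtain ⟨a, b, hab, hab1⟩ := exists_support hf one_pos
  have hD0 := fDiv_ge P Q hab hab hA
  have hDS := fDiv_ge P Q h h' hA
  have k := h 1 one_pos
  have k' := h' 1 one_pos
  rw [hf1] at hab1 k k'
  simp only [measureReal_def] at *
  rw [hv0, hv1, hv0, hv1, ENNReal.toReal_ofReal (by linarith), ENNReal.toReal_ofReal (by linarith),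
    ENNReal.toReal_ofReal (by linarith), ENNReal.toReal_ofReal (by linarith)]
  simp only [← measureReal_def] at *
  rw [probReal_compl_eq_one_sub hA, probReal_compl_eq_one_sub hA] at hD0 hDS
  set p := P.real A
  set q := Q.real A
  set S := α * q + β * p + (α' * (1 - q) + β' * (1 - p)) with hS
  have e0 : a * q + b * p + (a * (1 - q) + b * (1 - p)) = 0 := by linarith
  rw [e0] at hD0
  have hmax : ((max S 0 : ℝ) : EReal) ≤ fDiv f P Q := by
    rcases max_choice S 0 with h | h <;> rw [h] <;> assumption
  refine le_trans (EReal.coe_le_coe_iff.2 ?_) hmax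
  have e1 : α * q + β * (q + V) + (α' * (1 - q) + β' * (1 - V - q)) =
      t * S + (1 - t) * ((α + β) * q + (α' + β') * (1 - q)) := by
    rw [htV, hS]; ring
  rw [e1]
  have e2 : (α + β) * q + (α' + β') * (1 - q) ≤ 0 := by
    have := mul_nonneg (show 0 ≤ -(α + β) by linarith) hQ0
    have := mul_nonneg (show 0 ≤ -(α' + β') by linarith) (show 0 ≤ 1 - q by linarith)
    linarith
  have e3 : t * S ≤ t * max S 0 := mul_le_mul_of_nonneg_left (le_max_left _ _) ht0
  have e4 : t * max S 0 ≤ 1 * max S 0 := mul_le_mul_of_nonneg_right ht1 (le_max_right _ _)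
  have e5 := mul_nonneg (show 0 ≤ 1 - t by linarith) (neg_nonneg.2 e2)
  linarith

/-- **Corollary 1 (Gilardoni).** The infimum `B(V)` of `D_f(P‖Q)` subject to `V(P,Q) ≥ V`
equals `inf{T(q,V) : 0 ≤ q ≤ 1-V}` where
`T(q,V) = (1-q) f((1-V-q)/(1-q)) + q f((q+V)/q)` (with boundary values interpreted via `f(0)`
and `f'(∞)`; equivalently `T(q,V)` is the `f`-divergence of the two-point pair
`P = (1-V-q, q+V)`, `Q = (1-q, q)`). Consequently
`D_f(P‖Q) ≥ inf{T(q, V(P,Q)) : 0 ≤ q ≤ 1-V(P,Q)}` for all `P, Q`, and this inequality is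
sharp. -/
theorem gilardoni_general (f : ℝ → ℝ)
    (hf : ConvexOn ℝ (Set.Ioi 0) f) (hf1 : f 1 = 0) :
    (∀ V : ℝ, 0 ≤ V → V ≤ 1 →
      sInf {x : EReal | ∃ pp : PMPair, V ≤ tvDist pp.P pp.Q ∧ x = fDiv f pp.P pp.Q} =
      sInf {x : EReal | ∃ r : ℝ, 0 ≤ r ∧ r ≤ 1 - V ∧
        ∃ P Q : Measure (Fin 2), IsProbabilityMeasure P ∧ IsProbabilityMeasure Q ∧
          P {0} = ENNReal.ofReal (1 - V - r) ∧ P {1} = ENNReal.ofReal (r + V) ∧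
          Q {0} = ENNReal.ofReal (1 - r) ∧ Q {1} = ENNReal.ofReal r ∧
          x = fDiv f P Q}) ∧
    ∀ pp : PMPair,
      sInf {x : EReal | ∃ r : ℝ, 0 ≤ r ∧ r ≤ 1 - tvDist pp.P pp.Q ∧
        ∃ P Q : Measure (Fin 2), IsProbabilityMeasure P ∧ IsProbabilityMeasure Q ∧
          P {0} = ENNReal.ofReal (1 - tvDist pp.P pp.Q - r) ∧
          P {1} = ENNReal.ofReal (r + tvDist pp.P pp.Q) ∧
          Q {0} = ENNReal.ofReal (1 - r) ∧ Q {1} = ENNReal.ofReal r ∧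
          x = fDiv f P Q} ≤ fDiv f pp.P pp.Q := by
  refine ⟨fun V hV0 hV1 => le_antisymm ?_ ?_, fun pp => ?_⟩
  · refine le_sInf ?_
    rintro x ⟨r, hr0, hr1, P, Q, iP, iQ, hP0, hP1, hQ0, hQ1, rfl⟩
    refine sInf_le ⟨⟨Fin 2, inferInstance, P, Q, iP, iQ⟩, ?_, rfl⟩
    have := tv_ge P Q (measurableSet_singleton 1)
    rw [measureReal_def, measureReal_def, hP1, hQ1, ENNReal.toReal_ofReal (by linarith),
      ENNReal.toReal_ofReal hr0] at this
    change V ≤ tvDist P Q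
    linarith
  · refine le_sInf ?_
    rintro x ⟨pp, hV, rfl⟩
    have := pp.probP
    have := pp.probQ
    obtain ⟨r, h0, h1, P', Q', i1, i2, a, b, c, d, hle⟩ :=
      two_point_exists hf hf1 pp.P pp.Q hV0 hV
    refine le_trans (sInf_le ?_) hle
    exact ⟨r, h0, h1, P', Q', i1, i2, a, b, c, d, rfl⟩
  · have := pp.probP
    have := pp.probQ
    have hV0 : 0 ≤ tvDist pp.P pp.Q :=
      div_nonneg (integral_nonneg fun x => abs_nonneg _) (by norm_num)
    obtain ⟨r, h0, h1, P', Q', i1, i2, a, b, c, d, hle⟩ :=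
      two_point_exists hf hf1 pp.P pp.Q hV0 le_rfl
    refine le_trans (sInf_le ?_) hle
    exact ⟨r, h0, h1, P', Q', i1, i2, a, b, c, d, rfl⟩

end
end
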